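/- arXiv:2512.18218 — 4 statements merged into one kernel-verified Lean document; each statement's English description precedes it below -/
import Mathlib

section
/- For every k ≥ 0, E[X_{k+1} ∣ ℱ_k] = A(h_k) X_k almost surely; equivalently, X_{k+1} = A(h_k) X_k + M_{k+1}, where M_{k+1} := X_{k+1} − A(h_k) X_k satisfies E[M_{k+1} ∣ ℱ_k] = 0 almost surely. -/
open MeasureTheory Matrix
open scoped ENNReal

/-- The event that the process `X` follows the word `x` up to time `k`. -/
def pathEvent {Ω : Type} {N : ℕ} (X : ℕ → Ω → (Fin N → ℝ)) (x : ℕ → Fin N) (k : ℕ) : Set Ω :=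
  {ω | ∀ l ≤ k, X l ω = Pi.single (x l) 1}

/-- The event that `X` follows the word `x` up to time `s` and then occupies the state `x s` at the
times `s + l` with `l < m`. -/
def holdEvent {Ω : Type} {N : ℕ} (X : ℕ → Ω → (Fin N → ℝ)) (x : ℕ → Fin N) (s m : ℕ) : Set Ω :=
  {ω | ω ∈ pathEvent X x s ∧ ∀ l < m, X (s + l) ω = Pi.single (x s) 1}

lemma single_one_injective {N : ℕ} {i j : Fin N}
    (hij : (Pi.single i 1 : Fin N → ℝ) = Pi.single j 1) : i = j := by
  by_contra hne
  have := congrFun hij i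
  simp [hne] at this

/-- The next jump time is the first later time at which the state has changed. -/
lemma nextJump_eq_coe_iff {E : Type} (f : ℕ → E) (s t : ℕ) :
    sInf ((fun k : ℕ => (k : ℕ∞)) '' {k : ℕ | (s : ℕ∞) < (k : ℕ∞) ∧ f k ≠ f s}) = (t : ℕ∞) ↔
      s < t ∧ f t ≠ f s ∧ ∀ l, s < l → l < t → f l = f s := by
  constructor
  · intro ht
    have hne : ((fun k : ℕ => (k : ℕ∞)) ''
        {k : ℕ | (s : ℕ∞) < (k : ℕ∞) ∧ f k ≠ f s}).Nonempty := by
      rw [Set.nonempty_iff_ne_empty]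
      intro h0
      rw [h0, sInf_empty] at ht
      exact ENat.top_ne_natCast t ht
    obtain ⟨k, ⟨hk, hkf⟩, hkt⟩ := csInf_mem hne
    rw [ht] at hkt
    obtain rfl : k = t := Nat.cast_injective hkt
    refine ⟨by exact_mod_cast hk, hkf, fun l hsl hlt => ?_⟩
    by_contra hl
    have := sInf_le (Set.mem_image_of_mem (fun k : ℕ => (k : ℕ∞))
      (show l ∈ {k : ℕ | (s : ℕ∞) < (k : ℕ∞) ∧ f k ≠ f s} from ⟨by exact_mod_cast hsl, hl⟩))
    rw [ht] at this
    have : k ≤ l := by exact_mod_cast this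
    omega
  · rintro ⟨hst, hf, hl⟩
    refine le_antisymm (sInf_le ⟨t, ⟨by exact_mod_cast hst, hf⟩, rfl⟩) (le_sInf ?_)
    rintro _ ⟨k, ⟨hk, hkf⟩, rfl⟩
    have hk' : s < k := by exact_mod_cast hk
    have : t ≤ k := by
      by_contra hkt
      exact hkf (hl k hk' (by omega))
    exact Nat.cast_le.2 this

/-- A word determines its last jump: its index `n`, its time `s` and the sojourn time `k - s + 1`. -/
lemma exists_lastJump {Ω : Type} {N : ℕ} (X : ℕ → Ω → (Fin N → ℝ))
    (τ : ℕ → Ω → ℕ∞) (hτ0 : ∀ ω, τ 0 ω = 0)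
    (hτrec : ∀ m ω, τ (m + 1) ω =
      sInf ((fun k : ℕ => (k : ℕ∞)) ''
        {k : ℕ | τ m ω < (k : ℕ∞) ∧ X k ω ≠ X (τ m ω).toNat ω}))
    (h : ℕ → Ω → ℕ) (hh0 : ∀ ω, h 0 ω = 1)
    (hhrec : ∀ k ω, h (k + 1) ω = if X (k + 1) ω = X k ω then h k ω + 1 else 1)
    (x : ℕ → Fin N) (k : ℕ) :
    ∃ n s d, k = s + d ∧ (∀ l ≤ d, x (s + l) = x s) ∧
      (∀ ω ∈ pathEvent X x s, τ n ω = (s : ℕ∞)) ∧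
      ∀ ω ∈ pathEvent X x k, h k ω = d + 1 := by
  induction k with
  | zero =>
    refine ⟨0, 0, 0, rfl, fun l hl => ?_, fun ω _ => by simp [hτ0], fun ω _ => by simp [hh0]⟩
    rw [Nat.le_zero.1 hl]
  | succ k ih =>
    obtain ⟨n, s, d, rfl, hconst, hτ, hh⟩ := ih
    have hmono : ∀ {a b}, a ≤ b → pathEvent X x b ⊆ pathEvent X x a :=
      fun hab ω hω l hl => hω l (hl.trans hab)
    by_cases hx : x (s + d + 1) = x (s + d)
    · refine ⟨n, s, d + 1, rfl, fun l hl => ?_, hτ, fun ω hω => ?_⟩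
      · rcases Nat.le_succ_iff.1 hl with hl | rfl
        · exact hconst l hl
        · exact hx.trans (hconst d le_rfl)
      · rw [hhrec, if_pos, hh ω (hmono (Nat.le_succ _) hω)]
        rw [hω _ le_rfl, hω _ (Nat.le_succ _), hx]
    · refine ⟨n + 1, s + d + 1, 0, rfl, fun l hl => ?_, fun ω hω => ?_, fun ω hω => ?_⟩
      · rw [Nat.le_zero.1 hl, Nat.add_zero]
      · rw [hτrec, hτ ω (hmono (by omega) hω), ENat.toNat_natCast,
          nextJump_eq_coe_iff (fun k => X k ω)]
        refine ⟨by omega, fun he => hx ?_, fun l hsl hl => ?_⟩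
        · rw [hω _ le_rfl, hω s (by omega)] at he
          rw [single_one_injective he, hconst d le_rfl]
        · have := hconst (l - s) (by omega)
          rw [Nat.add_sub_cancel' hsl.le] at this
          change X l ω = X s ω
          rw [hω l (by omega), hω s (by omega), this]
      · rw [hhrec, if_neg]
        intro he
        rw [hω _ le_rfl, hω _ (Nat.le_succ _)] at he
        exact hx (single_one_injective he)

lemma pathEvent_add {Ω : Type} {N : ℕ} (X : ℕ → Ω → (Fin N → ℝ)) (x : ℕ → Fin N) {s d : ℕ}
    (hconst : ∀ l ≤ d, x (s + l) = x s) :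
    pathEvent X x (s + d) = holdEvent X x s (d + 1) := by
  ext ω
  constructor
  · intro hω
    refine ⟨fun l hl => hω l (by omega), fun l hl => ?_⟩
    rw [hω (s + l) (by omega), hconst l (by omega)]
  · rintro ⟨hp, hl⟩ l hls
    by_cases hs : l ≤ s
    · exact hp l hs
    · obtain ⟨c, rfl⟩ := Nat.exists_eq_add_of_le (not_le.1 hs).le
      rw [hl c (by omega), hconst c (by omega)]

lemma holdEvent_one {Ω : Type} {N : ℕ} (X : ℕ → Ω → (Fin N → ℝ)) (x : ℕ → Fin N) (s : ℕ) :
    holdEvent X x s 1 = pathEvent X x s :=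
  (pathEvent_add X x (d := 0) fun l hl => by rw [Nat.le_zero.1 hl, Nat.add_zero]).symm

lemma holdEvent_inter_self {Ω : Type} {N : ℕ} (X : ℕ → Ω → (Fin N → ℝ)) (x : ℕ → Fin N)
    (s m : ℕ) :
    holdEvent X x s m ∩ {ω | X (s + m) ω = Pi.single (x s) 1} = holdEvent X x s (m + 1) := by
  ext ω
  constructor
  · rintro ⟨⟨hp, hl⟩, hm⟩
    refine ⟨hp, fun l hlm => ?_⟩
    rcases Nat.lt_succ_iff_lt_or_eq.1 hlm with hlm | rfl
    · exact hl l hlm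
    · exact hm
  · rintro ⟨hp, hl⟩
    exact ⟨⟨hp, fun l hlm => hl l (by omega)⟩, hl m (by omega)⟩

lemma measurableSet_pathEvent {Ω : Type} {m : MeasurableSpace Ω} {N : ℕ}
    {X : ℕ → Ω → (Fin N → ℝ)} (x : ℕ → Fin N) {k : ℕ} (hX : ∀ l ≤ k, Measurable[m] (X l)) :
    MeasurableSet[m] (pathEvent X x k) := by
  have : pathEvent X x k = ⋂ l, ⋂ (_ : l ≤ k), X l ⁻¹' {Pi.single (x l) 1} := by
    ext ω; simp [pathEvent]
  rw [this]
  exact MeasurableSet.iInter fun l => MeasurableSet.iInter fun hl =>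
    hX l hl (measurableSet_singleton _)

lemma measurableSet_holdEvent {Ω : Type} {m : MeasurableSpace Ω} {N : ℕ}
    {X : ℕ → Ω → (Fin N → ℝ)} (x : ℕ → Fin N) (s d : ℕ) (hX : ∀ l, Measurable[m] (X l)) :
    MeasurableSet[m] (holdEvent X x s d) := by
  have : holdEvent X x s d =
      pathEvent X x s ∩ ⋂ l, ⋂ (_ : l < d), X (s + l) ⁻¹' {Pi.single (x s) 1} := by
    ext ω; simp [holdEvent]
  rw [this]
  exact (measurableSet_pathEvent x fun l _ => hX l).inter
    (MeasurableSet.iInter fun l => MeasurableSet.iInter fun _ =>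
      hX _ (measurableSet_singleton _))

lemma measureReal_eq_sum_inter_state {Ω : Type} {mΩ : MeasurableSpace Ω} (μ : Measure Ω)
    [IsFiniteMeasure μ] {N : ℕ} {Z : Ω → (Fin N → ℝ)} (hZ : Measurable Z)
    (hZval : ∀ ω, ∃ i, Z ω = Pi.single i 1) {H : Set Ω} (hH : MeasurableSet H) :
    μ.real H = ∑ j, μ.real (H ∩ {ω | Z ω = Pi.single j 1}) := by
  have hU : H = ⋃ j ∈ (Finset.univ : Finset (Fin N)), H ∩ {ω | Z ω = Pi.single j 1} := by
    ext ω
    obtain ⟨i, hi⟩ := hZval ω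
    simp only [Finset.mem_univ, Set.iUnion_true, Set.mem_iUnion, Set.mem_inter_iff,
      Set.mem_ofPred_eq]
    exact ⟨fun hω => ⟨i, hω, hi⟩, fun ⟨_, hω, _⟩ => hω⟩
  conv_lhs => rw [hU]
  refine measureReal_biUnion_finset (fun i _ j _ hij => ?_)
    fun j _ => hH.inter (hZ (measurableSet_singleton _))
  refine Set.disjoint_left.2 fun ω h1 h2 => hij ?_
  exact single_one_injective (h1.2.symm.trans h2.2)

/-- On the word `x` up to its jump time `s = τ n`, the next jump goes to `j` after `m` steps exactly
when the state `x s` is held for `m` steps and then replaced by `j`. -/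
lemma pathEvent_inter_nextJump {Ω : Type} {N : ℕ} (X : ℕ → Ω → (Fin N → ℝ))
    (τ : ℕ → Ω → ℕ∞)
    (hτrec : ∀ m ω, τ (m + 1) ω =
      sInf ((fun k : ℕ => (k : ℕ∞)) ''
        {k : ℕ | τ m ω < (k : ℕ∞) ∧ X k ω ≠ X (τ m ω).toNat ω}))
    (x : ℕ → Fin N) {n s : ℕ} (hτ : ∀ ω ∈ pathEvent X x s, τ n ω = (s : ℕ∞))
    {m : ℕ} (hm : 1 ≤ m) {j : Fin N} (hj : j ≠ x s) :
    pathEvent X x s ∩ {ω | τ n ω ≠ ⊤ ∧ X (τ n ω).toNat ω = Pi.single (x s) 1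
            ∧ τ (n + 1) ω = τ n ω + (m : ℕ∞)
            ∧ X (τ (n + 1) ω).toNat ω = Pi.single j 1} =
      holdEvent X x s m ∩ {ω | X (s + m) ω = Pi.single j 1} := by
  ext ω
  constructor
  · rintro ⟨hp, -, -, h1, h2⟩
    rw [hτ ω hp, ← Nat.cast_add] at h1
    rw [h1, ENat.toNat_natCast] at h2
    rw [hτrec, hτ ω hp, ENat.toNat_natCast, nextJump_eq_coe_iff (fun k => X k ω)] at h1
    refine ⟨⟨hp, fun l hl => ?_⟩, h2⟩
    rcases Nat.eq_zero_or_pos l with rfl | hl0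
    · exact hp s le_rfl
    · exact (h1.2.2 (s + l) (by omega) (by omega)).trans (hp s le_rfl)
  · rintro ⟨⟨hp, hl⟩, hmj⟩
    have h1 : τ (n + 1) ω = ((s + m : ℕ) : ℕ∞) := by
      rw [hτrec, hτ ω hp, ENat.toNat_natCast, nextJump_eq_coe_iff (fun k => X k ω)]
      refine ⟨by omega, fun he => hj ?_, fun l hsl hlt => ?_⟩
      · exact single_one_injective (hmj.symm.trans (he.trans (hp s le_rfl)))
      · obtain ⟨c, rfl⟩ := Nat.exists_eq_add_of_le hsl.le
        exact (hl c (by omega)).trans (hp s le_rfl).symm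
    refine ⟨hp, ?_, ?_, ?_, ?_⟩
    · rw [hτ ω hp]; exact ENat.natCast_ne_top s
    · rw [hτ ω hp, ENat.toNat_natCast]; exact hp s le_rfl
    · rw [h1, hτ ω hp, Nat.cast_add]
    · rw [h1, ENat.toNat_natCast]; exact hmj

/-- If from the state `x s` the probability of a first exit to `j ≠ x s` after `m` steps is `p j m`,
then the state is held for `m` further steps with probability `1 - ∑_{l ≤ m} ∑_j p j l`. -/
lemma measureReal_holdEvent {Ω : Type} {mΩ : MeasurableSpace Ω} (μ : Measure Ω)
    [IsFiniteMeasure μ] {N : ℕ} {X : ℕ → Ω → (Fin N → ℝ)} (hXmeas : ∀ k, Measurable (X k))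
    (hXval : ∀ k ω, ∃ i, X k ω = Pi.single i 1) (x : ℕ → Fin N) (s : ℕ)
    (p : Fin N → ℕ → ℝ) (hp : ∀ m, p (x s) m = 0)
    (hexit : ∀ m, 1 ≤ m → ∀ j, j ≠ x s →
      μ.real (holdEvent X x s m ∩ {ω | X (s + m) ω = Pi.single j 1}) =
        p j m * μ.real (pathEvent X x s)) (m : ℕ) :
    μ.real (holdEvent X x s (m + 1)) =
      (1 - ∑ l ∈ Finset.Icc 1 m, ∑ j, p j l) * μ.real (pathEvent X x s) := by
  induction m with
  | zero => simp [holdEvent_one]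
  | succ m ih =>
    have hsum := measureReal_eq_sum_inter_state μ (hXmeas (s + (m + 1))) (hXval (s + (m + 1)))
      (measurableSet_holdEvent x s (m + 1) hXmeas)
    rw [← Finset.add_sum_erase _ _ (Finset.mem_univ (x s)), holdEvent_inter_self,
      Finset.sum_congr rfl fun j hj =>
        hexit (m + 1) (by omega) j (Finset.ne_of_mem_erase hj), ← Finset.sum_mul, ih] at hsum
    have hsplit := Finset.add_sum_erase Finset.univ (fun j => p j (m + 1)) (Finset.mem_univ (x s))
    simp only [hp, zero_add] at hsplit
    rw [hsplit] at hsum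
    rw [Finset.sum_Icc_succ_top (by omega)]
    linarith

/-- If `f` and `g` have the same integral over the fibres of a finite-valued map `Y` generating `m`,
then `g` is the conditional expectation of `f`, and `f - g` has conditional expectation zero,
provided `g` factors through `Y`. -/
lemma condExp_ae_eq_of_fibres {Ω T : Type} {m mΩ : MeasurableSpace Ω} (hm : m ≤ mΩ)
    (μ : Measure Ω) [IsFiniteMeasure μ] [Finite T] (Y : Ω → T)
    (hY : ∀ t, MeasurableSet[m] (Y ⁻¹' {t})) (hmY : ∀ B, MeasurableSet[m] B → ∃ S, B = Y ⁻¹' S)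
    {f g : Ω → ℝ} (hf : Integrable f μ) (c : T → ℝ) (hg : ∀ ω, g ω = c (Y ω))
    (hint : ∀ t, ∫ ω in Y ⁻¹' {t}, f ω ∂μ = c t * μ.real (Y ⁻¹' {t})) :
    μ[f | m] =ᵐ[μ] g ∧ μ[f - g | m] =ᵐ[μ] 0 := by
  obtain rfl : g = c ∘ Y := funext hg
  let _ : MeasurableSpace T := ⊤
  have hYm : Measurable[m] Y := @measurable_to_countable' T Ω _ _ m Y hY
  have hgm : Measurable[m] (c ∘ Y) := (measurable_of_finite c).comp hYm
  have hgi : Integrable (c ∘ Y) μ := by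
    obtain ⟨C, hC⟩ := (Set.finite_range fun t => ‖c t‖).bddAbove
    exact Integrable.of_bound (hgm.mono hm le_rfl).aestronglyMeasurable C
      (Filter.Eventually.of_forall fun ω => hC ⟨Y ω, rfl⟩)
  suffices hfg : μ[f | m] =ᵐ[μ] c ∘ Y by
    refine ⟨hfg, (condExp_sub hf hgi m).trans ?_⟩
    rw [condExp_of_stronglyMeasurable hm hgm.stronglyMeasurable hgi]
    filter_upwards [hfg] with ω hω
    simp [hω]
  refine (ae_eq_condExp_of_forall_setIntegral_eq hm hf (fun _ _ _ => hgi.integrableOn)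
    (fun B hB _ => ?_) hgm.stronglyMeasurable.aestronglyMeasurable).symm
  obtain ⟨S, rfl⟩ := hmY B hB
  have hU : Y ⁻¹' S = ⋃ t ∈ (Set.toFinite S).toFinset, Y ⁻¹' {t} := by
    ext ω; simp
  have hdisj : Set.Pairwise (↑(Set.toFinite S).toFinset)
      (Function.onFun Disjoint fun t => Y ⁻¹' {t}) := fun a _ b _ hab =>
    Disjoint.preimage Y (Set.disjoint_singleton.2 hab)
  rw [hU, integral_biUnion_finset _ (fun t _ => hm _ (hY t)) hdisj fun _ _ => hgi.integrableOn,
    integral_biUnion_finset _ (fun t _ => hm _ (hY t)) hdisj fun _ _ => hf.integrableOn]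
  refine Finset.sum_congr rfl fun t _ => ?_
  have hconst : ∫ ω in Y ⁻¹' {t}, (c ∘ Y) ω ∂μ = ∫ _ in Y ⁻¹' {t}, c t ∂μ :=
    setIntegral_congr_fun (hm _ (hY t)) fun ω hω => congrArg c hω
  rw [hint t, hconst, setIntegral_const, smul_eq_mul, mul_comm]

/-- For every `k ≥ 0`, `E[X_{k+1} ∣ ℱ_k] = A(h_k) X_k` almost surely;
equivalently `X_{k+1} = A(h_k)X_k + M_{k+1}` with `E[M_{k+1} ∣ ℱ_k] = 0` a.s. -/
theorem statement1
    {Ω : Type} {mΩ : MeasurableSpace Ω} (μ : Measure Ω) [IsProbabilityMeasure μ]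
    (N : ℕ) (hN : 1 ≤ N)
    (X : ℕ → Ω → (Fin N → ℝ))
    (hXmeas : ∀ k, Measurable (X k))
    (hXval : ∀ k ω, ∃ i, X k ω = Pi.single i 1)
    -- the filtration generated by the chain
    (F : ℕ → MeasurableSpace Ω)
    (hF : ∀ k, F k = ⨆ j ∈ Finset.range (k + 1), MeasurableSpace.comap (X j) inferInstance)
    -- jump times
    (τ : ℕ → Ω → ℕ∞)
    (hτ0 : ∀ ω, τ 0 ω = 0)
    (hτrec : ∀ m ω, τ (m + 1) ω =
      sInf ((fun k : ℕ => (k : ℕ∞)) ''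
        {k : ℕ | τ m ω < (k : ℕ∞) ∧ X k ω ≠ X (τ m ω).toNat ω}))
    -- the sojourn-time process (`h_k = 1 + ⟨X_k, X_{k-1}⟩ h_{k-1}`, `h_0 = 1`)
    (h : ℕ → Ω → ℕ)
    (hh0 : ∀ ω, h 0 ω = 1)
    (hhrec : ∀ k ω, h (k + 1) ω = if X (k + 1) ω = X k ω then h k ω + 1 else 1)
    -- the semi-Markov kernel
    (q : Fin N → Fin N → ℕ → ℝ)
    (hq01 : ∀ j i m, 0 ≤ q j i m ∧ q j i m ≤ 1)
    (hqdiag : ∀ i m, q i i m = 0)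
    -- time-homogeneous semi-Markov property:
    -- `P(X_{τ_{n+1}} = e_j, τ_{n+1} − τ_n = m ∣ ℱ_{τ_n}) = q(j,i,m)`
    -- a.s. on `{τ_n < ∞} ∩ {X_{τ_n} = e_i}`
    (hSM : ∀ (nn : ℕ) (i j : Fin N) (m : ℕ), 1 ≤ m → ∀ A : Set Ω,
      (MeasurableSet A ∧ ∀ k : ℕ, MeasurableSet[F k] (A ∩ {ω | τ nn ω = (k : ℕ∞)})) →
      μ (A ∩ {ω | τ nn ω ≠ ⊤ ∧ X (τ nn ω).toNat ω = Pi.single i 1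
            ∧ τ (nn + 1) ω = τ nn ω + (m : ℕ∞)
            ∧ X (τ (nn + 1) ω).toNat ω = Pi.single j 1})
        = ENNReal.ofReal (q j i m)
            * μ (A ∩ {ω | τ nn ω ≠ ⊤ ∧ X (τ nn ω).toNat ω = Pi.single i 1}))
    -- `π_i(m)`, `F_i(m)`, `Δ^i(m)` and the matrices `A(m)`
    (π : Fin N → ℕ → ℝ) (hπ : ∀ i m, π i m = ∑ j, q j i m)
    (Fs : Fin N → ℕ → ℝ)
    (hFs : ∀ i m, Fs i m = 1 - ∑ l ∈ Finset.Icc 1 m, π i l)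
    (hFspos : ∀ i m, 0 < Fs i m)
    (Δ : Fin N → ℕ → ℝ) (hΔ : ∀ i m, Δ i m = π i m / Fs i (m - 1))
    (A : ℕ → Matrix (Fin N) (Fin N) ℝ)
    (hA : ∀ m (j i : Fin N),
      A m j i = if j = i then 1 - Δ i m else q j i m / Fs i (m - 1)) :
    ∀ k : ℕ, ∀ j : Fin N,
      ((μ[(fun ω => X (k + 1) ω j) | F k]) =ᵐ[μ] fun ω => (A (h k ω) *ᵥ X k ω) j)
      ∧ ((μ[(fun ω => X (k + 1) ω j - (A (h k ω) *ᵥ X k ω) j) | F k]) =ᵐ[μ] 0) := by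
  have hFX : ∀ {k l}, l ≤ k → Measurable[F k] (X l) := by
    intro k l hl
    have : MeasurableSpace.comap (X l) inferInstance ≤ F k := by
      rw [hF]
      exact le_iSup₂_of_le l (Finset.mem_range.2 (by omega)) le_rfl
    exact Measurable.mono (comap_measurable (X l)) this le_rfl
  have hFle : ∀ k, F k ≤ mΩ := fun k => by
    rw [hF]
    exact iSup₂_le fun l _ => (hXmeas l).comap_le
  choose Y hY using hXval
  have hXval : ∀ k ω, ∃ i, X k ω = Pi.single i 1 := fun k ω => ⟨Y k ω, hY k ω⟩
  intro k j
  -- words of length `k + 1`, and the states they visit at the times `l ≤ k`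
  let W : Ω → (Fin (k + 1) → Fin N) := fun ω l => Y l ω
  let ext : (Fin (k + 1) → Fin N) → ℕ → Fin N := fun w l => w (Fin.ofNat (k + 1) l)
  have hext : ∀ w l (hl : l < k + 1), ext w l = w ⟨l, hl⟩ := fun w l hl => by
    simp only [ext]
    congr 1
    ext
    simp [Nat.mod_eq_of_lt hl]
  have hWpre : ∀ w, W ⁻¹' {w} = pathEvent X (ext w) k := by
    intro w
    ext ω
    constructor
    · rintro rfl l hl
      have hl' : ext (W ω) l = Y l ω :=
        hext (W ω) l (Nat.lt_succ_of_le hl)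
      rw [hl']
      exact hY l ω
    · intro hω
      funext l
      have := hω l (by omega)
      rw [hext w l l.2, hY] at this
      exact single_one_injective this
  have hWmeas : ∀ B, MeasurableSet[F k] B → ∃ S, B = W ⁻¹' S := by
    let _ : MeasurableSpace (Fin (k + 1) → Fin N) := ⊤
    have hle : F k ≤ MeasurableSpace.comap W ⊤ := by
      rw [hF]
      refine iSup₂_le fun l hl => ?_
      have hl' := Finset.mem_range.1 hl
      have hX : X l = (fun w : Fin (k + 1) → Fin N => (Pi.single (w ⟨l, hl'⟩) 1 : Fin N → ℝ)) ∘ W :=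
        funext fun ω => hY l ω
      rw [hX, ← MeasurableSpace.comap_comp]
      exact MeasurableSpace.comap_mono le_top
    intro B hB
    obtain ⟨S, -, hS⟩ := hle B hB
    exact ⟨S, hS.symm⟩
  choose n s d hk hconst hτ hh using
    fun w => exists_lastJump X τ hτ0 hτrec h hh0 hhrec (ext w) k
  let c : (Fin (k + 1) → Fin N) → ℝ := fun w => A (d w + 1) j (ext w (s w))
  have hg : ∀ ω, (A (h k ω) *ᵥ X k ω) j = c (W ω) := by
    intro ω
    have hω : ω ∈ pathEvent X (ext (W ω)) k := by rw [← hWpre]; rfl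
    have hXk := hω k le_rfl
    have hxk := hconst (W ω) (d (W ω)) le_rfl
    rw [← hk] at hxk
    rw [hh _ ω hω, hXk, hxk]
    simp [c]
  have hXj : ∀ ω, X (k + 1) ω j = {ω | X (k + 1) ω = Pi.single j 1}.indicator 1 ω := by
    intro ω
    by_cases hω : X (k + 1) ω = Pi.single j 1
    · simp [Set.indicator, hω]
    · have hne : j ≠ Y (k + 1) ω := fun he => hω (he ▸ hY _ _)
      simp only [Set.indicator, Set.mem_ofPred_eq, hω, if_false]
      rw [hY, Pi.single_eq_of_ne hne]
  have hmeasj : MeasurableSet {ω | X (k + 1) ω = Pi.single j 1} :=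
    hXmeas _ (measurableSet_singleton _)
  have hfi : Integrable (fun ω => X (k + 1) ω j) μ := by
    rw [funext hXj]
    exact (integrable_const (1 : ℝ)).indicator hmeasj
  have hint : ∀ w, ∫ ω in W ⁻¹' {w}, X (k + 1) ω j ∂μ = c w * μ.real (W ⁻¹' {w}) := by
    intro w
    have hexit : ∀ m, 1 ≤ m → ∀ j, j ≠ ext w (s w) →
        μ.real (holdEvent X (ext w) (s w) m ∩ {ω | X (s w + m) ω = Pi.single j 1}) =
          q j (ext w (s w)) m * μ.real (pathEvent X (ext w) (s w)) := by
      intro m hm j hj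
      have hSM' := hSM (n w) (ext w (s w)) j m hm (pathEvent X (ext w) (s w))
        ⟨measurableSet_pathEvent _ fun l _ => hXmeas l, fun t => ?_⟩
      · have hsub : pathEvent X (ext w) (s w) ⊆ {ω | τ (n w) ω ≠ ⊤ ∧
            X (τ (n w) ω).toNat ω = Pi.single (ext w (s w)) 1} := by
          intro ω hω
          simp only [Set.mem_ofPred_eq, hτ w ω hω, ENat.toNat_natCast]
          exact ⟨ENat.natCast_ne_top _, hω _ le_rfl⟩
        rw [pathEvent_inter_nextJump X τ hτrec _ (hτ w) hm hj, Set.inter_eq_left.2 hsub] at hSM'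
        rw [measureReal_def, hSM', ENNReal.toReal_mul, ENNReal.toReal_ofReal (hq01 _ _ _).1,
          measureReal_def]
      · by_cases ht : t = s w
        · subst ht
          have hsub : pathEvent X (ext w) (s w) ⊆ {ω | τ (n w) ω = (s w : ℕ∞)} := hτ w
          rw [Set.inter_eq_left.2 hsub]
          exact measurableSet_pathEvent _ fun l hl => hFX hl
        · convert @MeasurableSet.empty Ω (F t)
          refine Set.eq_empty_of_forall_notMem fun ω hω => ht ?_
          have : (t : ℕ∞) = s w := hω.2.symm.trans (hτ w ω hω.1)
          exact_mod_cast this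
    have hhold : ∀ m, μ.real (holdEvent X (ext w) (s w) (m + 1)) =
        Fs (ext w (s w)) m * μ.real (pathEvent X (ext w) (s w)) := by
      intro m
      rw [measureReal_holdEvent μ hXmeas hXval (ext w) (s w) (fun j m => q j (ext w (s w)) m)
        (fun m => hqdiag _ m) hexit m, hFs]
      simp only [hπ]
    have hpos := (hFspos (ext w (s w)) (d w)).ne'
    have hE : W ⁻¹' {w} = holdEvent X (ext w) (s w) (d w + 1) := by
      rw [hWpre, ← pathEvent_add X (ext w) (hconst w), ← hk]
    have hkd : k + 1 = s w + (d w + 1) := by have := hk w; omega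
    rw [funext hXj, setIntegral_indicator hmeasj, hE, hhold]
    simp only [Pi.one_apply, setIntegral_const, smul_eq_mul, mul_one, hkd, c, hA,
      Nat.add_sub_cancel]
    by_cases hj : j = ext w (s w)
    · rw [if_pos hj, hj, holdEvent_inter_self, hhold, hΔ, Nat.add_sub_cancel]
      have hrec : Fs (ext w (s w)) (d w + 1) =
          Fs (ext w (s w)) (d w) - π (ext w (s w)) (d w + 1) := by
        rw [hFs, hFs, Finset.sum_Icc_succ_top (by omega)]
        ring
      rw [hrec]
      field_simp
    · rw [if_neg hj, hexit _ (by omega) j hj]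
      field_simp
  exact condExp_ae_eq_of_fibres (hFle k) μ W
    (fun w => by rw [hWpre]; exact measurableSet_pathEvent _ fun l hl => hFX hl)
    hWmeas hfi c hg hint
end

section
/- For every 0 ≤ k ≤ T−1, E[X̄_{k+1} ∣ ℱ_k] = C X̄_k almost surely; equivalently X̄_{k+1} = C X̄_k + M̄_{k+1}, where M̄_{k+1} := X̄_{k+1} − C X̄_k satisfies E[M̄_{k+1} ∣ ℱ_k] = 0 almost surely. -/
open MeasureTheory Matrix
open scoped ENNReal

/-- The time `s` is a jump time of the path `x`, time `0` included. -/
def IsJumpTime {V : Type*} (x : ℕ → V) (s : ℕ) : Prop := ∀ r, s = r + 1 → x s ≠ x r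

/-- The path `x` is constant on `[s, s + m)`. -/
def ConstFrom {V : Type*} (x : ℕ → V) (s m : ℕ) : Prop := ∀ l < m, x (s + l) = x s

section Path

variable {V : Type*} {x : ℕ → V} {t : ℕ → ℕ∞}

lemma constFrom_one (s : ℕ) : ConstFrom x s 1 := by
  intro l hl
  obtain rfl : l = 0 := by omega
  rfl

lemma constFrom_succ {s m : ℕ} :
    ConstFrom x s (m + 1) ↔ ConstFrom x s m ∧ x (s + m) = x s := by
  constructor
  · exact fun H => ⟨fun l hl => H l (by omega), H m (by omega)⟩
  · rintro ⟨H, H'⟩ l hl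
    rcases Nat.lt_succ_iff_lt_or_eq.mp hl with hl | rfl
    · exact H l hl
    · exact H'

lemma sojourn_eq_iff {c : ℕ → ℕ} (h0 : c 0 = 1) [DecidableEq V]
    (hrec : ∀ k, c (k + 1) = if x (k + 1) = x k then c k + 1 else 1) (k : ℕ) :
    ∀ s m, 1 ≤ m → s + m = k + 1 → (c k = m ↔ IsJumpTime x s ∧ ConstFrom x s m) := by
  have hpos : ∀ k, 1 ≤ c k := by
    intro k
    cases k with
    | zero => omega
    | succ k => rw [hrec]; split_ifs <;> omega
  induction k with
  | zero =>
    intro s m hm hs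
    obtain rfl : m = 1 := by omega
    obtain rfl : s = 0 := by omega
    exact ⟨fun _ => ⟨fun r hr => by omega, constFrom_one 0⟩, fun _ => h0⟩
  | succ k ih =>
    intro s m hm hs
    rcases Nat.eq_or_lt_of_le hm with rfl | hm
    · obtain rfl : s = k + 1 := by omega
      have hk := hpos k
      rw [hrec]
      constructor
      · intro H
        refine ⟨?_, constFrom_one _⟩
        intro r hr
        obtain rfl : k = r := by omega
        intro he
        rw [if_pos he] at H
        omega
      · rintro ⟨H, -⟩
        rw [if_neg (H k rfl)]
    · obtain ⟨m, rfl⟩ : ∃ m', m = m' + 1 := ⟨m - 1, by omega⟩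
      have hsm : s + m = k + 1 := by omega
      have hk := ih s m (by omega) hsm
      have hlast : ConstFrom x s m → x k = x s := by
        intro H
        have := H (m - 1) (by omega)
        rwa [show s + (m - 1) = k by omega] at this
      rw [constFrom_succ, ← and_assoc, hrec]
      constructor
      · intro H
        split_ifs at H with he
        · have := hk.mp (by omega)
          refine ⟨this, ?_⟩
          rw [hsm, he, hlast this.2]
        · omega
      · rintro ⟨H, H'⟩
        rw [if_pos, hk.mpr H]
        rw [hlast H.2, ← H', hsm]

lemma sojourn_le {c : ℕ → ℕ} (h0 : c 0 = 1) [DecidableEq V]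
    (hrec : ∀ k, c (k + 1) = if x (k + 1) = x k then c k + 1 else 1) (k : ℕ) :
    1 ≤ c k ∧ c k ≤ k + 1 := by
  induction k with
  | zero => omega
  | succ k ih => rw [hrec]; split_ifs <;> omega

variable (htrec : ∀ n, t (n + 1) = sInf ((fun k : ℕ => (k : ℕ∞)) ''
  {k : ℕ | t n < (k : ℕ∞) ∧ x k ≠ x (t n).toNat}))

include htrec

lemma jump_succ_mem {n s k : ℕ} (hs : t n = s) (hk : t (n + 1) = k) : s < k ∧ x k ≠ x s := by
  have hne : ((fun k : ℕ => (k : ℕ∞)) ''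
      {k : ℕ | t n < (k : ℕ∞) ∧ x k ≠ x (t n).toNat}).Nonempty := by
    by_contra hcon
    rw [Set.not_nonempty_iff_eq_empty] at hcon
    rw [htrec, hcon, sInf_empty] at hk
    exact ENat.top_ne_natCast k hk
  obtain ⟨l, hl, hlk⟩ := csInf_mem hne
  rw [← htrec, hk] at hlk
  obtain rfl : l = k := Nat.cast_injective hlk
  simpa [hs] using hl

lemma jump_ne_top {n k : ℕ} (hk : t (n + 1) = k) : t n ≠ ⊤ := by
  intro htop
  rw [htrec, htop] at hk
  simp at hk

lemma jump_succ_le {n s l : ℕ} (hs : t n = s) (hl : s < l) (hx : x l ≠ x s) :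
    t (n + 1) ≤ l := by
  rw [htrec]
  refine sInf_le ⟨l, ?_, rfl⟩
  simpa [hs] using And.intro hl hx

lemma jump_lt_succ {n s : ℕ} (hs : t n = s) : (s : ℕ∞) < t (n + 1) := by
  cases hk : t (n + 1) with
  | top => exact ENat.natCast_lt_top s
  | coe k => exact_mod_cast (jump_succ_mem htrec hs hk).1

lemma jump_succ_eq_iff {n s m : ℕ} (hs : t n = s) (hm : 1 ≤ m) :
    t (n + 1) = ((s + m : ℕ) : ℕ∞) ↔ ConstFrom x s m ∧ x (s + m) ≠ x s := by
  constructor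
  · intro H
    refine ⟨fun l hl => ?_, (jump_succ_mem htrec hs H).2⟩
    by_contra hne
    have hpos : l ≠ 0 := by rintro rfl; exact hne rfl
    have := jump_succ_le htrec hs (l := s + l) (by omega) hne
    rw [H] at this
    have : s + m ≤ s + l := by exact_mod_cast this
    omega
  · rintro ⟨H, H'⟩
    have hle := jump_succ_le htrec hs (l := s + m) (by omega) H'
    obtain ⟨k, hk⟩ := ENat.ne_top_iff_exists.mp (ne_top_of_le_ne_top (ENat.natCast_ne_top _) hle)
    rw [← hk] at hle ⊢
    obtain ⟨h1, h2⟩ := jump_succ_mem htrec hs hk.symm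
    have hle' : k ≤ s + m := by exact_mod_cast hle
    have : ¬ k < s + m := by
      intro hlt
      apply h2
      have := H (k - s) (by omega)
      rwa [show s + (k - s) = k by omega] at this
    rw [show k = s + m by omega]

lemma exists_jump_le_lt (ht0 : t 0 = 0) (s : ℕ) : ∃ n, t n ≤ s ∧ (s : ℕ∞) < t (n + 1) := by
  induction s with
  | zero => exact ⟨0, by simp [ht0], by exact_mod_cast jump_lt_succ htrec (s := 0) (by simp [ht0])⟩
  | succ s ih =>
    obtain ⟨n, h1, h2⟩ := ih
    by_cases heq : t (n + 1) = ((s + 1 : ℕ) : ℕ∞)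
    · exact ⟨n + 1, heq.le, jump_lt_succ htrec heq⟩
    · refine ⟨n, h1.trans (by exact_mod_cast Nat.le_succ s), lt_of_le_of_ne ?_ (Ne.symm heq)⟩
      push_cast
      exact Order.add_one_le_of_lt h2

lemma isJumpTime_iff (ht0 : t 0 = 0) (s : ℕ) : IsJumpTime x s ↔ ∃ n, t n = s := by
  constructor
  · intro H
    obtain ⟨n, h1, h2⟩ := exists_jump_le_lt htrec ht0 s
    obtain ⟨r, hr⟩ := ENat.ne_top_iff_exists.mp (ne_top_of_le_ne_top (ENat.natCast_ne_top _) h1)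
    refine ⟨n, ?_⟩
    have hconst : ∀ l : ℕ, r ≤ l → l ≤ s → x l = x r := by
      intro l hl hls
      by_contra hne
      have hlt : r < l := lt_of_le_of_ne hl (by rintro rfl; exact hne rfl)
      have := (h2.trans_le (jump_succ_le htrec hr.symm hlt hne))
      have : s < l := by exact_mod_cast this
      omega
    rw [← hr] at h1 ⊢
    have hle : r ≤ s := by exact_mod_cast h1
    rcases hle.eq_or_lt with rfl | hlt
    · rfl
    · exact absurd ((hconst s hle le_rfl).trans (hconst (s - 1) (by omega) (by omega)).symm)
        (H (s - 1) (by omega))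
  · rintro ⟨n, hn⟩ r rfl
    cases n with
    | zero =>
      rw [ht0] at hn
      exact absurd hn.symm (by simp)
    | succ n =>
      obtain ⟨u, hu⟩ := ENat.ne_top_iff_exists.mp (jump_ne_top htrec hn)
      have hlt := (jump_succ_mem htrec hu.symm hn).1
      obtain ⟨m, rfl⟩ : ∃ m, r = u + m := ⟨r - u, by omega⟩
      obtain ⟨h1, h2⟩ := (jump_succ_eq_iff htrec hu.symm (m := m + 1) (by omega)).mp hn
      rw [h1 m (by omega)]
      exact h2

lemma jump_injective {n n' s : ℕ} (hn : t n = s) (hn' : t n' = s) : n = n' := by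
  have hmono : Monotone t := by
    refine monotone_nat_of_le_succ fun n => ?_
    cases hs : t n with
    | top => rw [htrec, hs]; simp
    | coe s => exact (jump_lt_succ htrec hs).le
  by_contra hne
  rcases lt_or_gt_of_ne hne with hlt | hlt
  · have := (jump_lt_succ htrec hn).trans_le (hmono (Nat.succ_le_of_lt hlt))
    exact absurd this (by simp [hn'])
  · have := (jump_lt_succ htrec hn').trans_le (hmono (Nat.succ_le_of_lt hlt))
    exact absurd this (by simp [hn])

lemma jump_succ_eq_iff_exists {n k : ℕ} :
    t (n + 1) = k ↔ ∃ r < k, t n = r ∧ ConstFrom x r (k - r) ∧ x k ≠ x r := by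
  constructor
  · intro hk
    obtain ⟨u, hu⟩ := ENat.ne_top_iff_exists.mp (jump_ne_top htrec hk)
    have hlt := (jump_succ_mem htrec hu.symm hk).1
    obtain ⟨m, rfl⟩ : ∃ m, k = u + m := ⟨k - u, by omega⟩
    have := (jump_succ_eq_iff htrec hu.symm (m := m) (by omega)).mp hk
    exact ⟨u, hlt, hu.symm, by simpa using this⟩
  · rintro ⟨r, hr, hn, H⟩
    obtain ⟨m, rfl⟩ : ∃ m, k = r + m := ⟨k - r, by omega⟩
    exact (jump_succ_eq_iff htrec hn (by omega)).mpr (by simpa using H)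

end Path

lemma single_one_inj {N : ℕ} {i j : Fin N} :
    (Pi.single i 1 : Fin N → ℝ) = Pi.single j 1 ↔ i = j := by
  constructor
  · intro H
    by_contra hne
    have := congrFun H i
    simp [hne] at this
  · rintro rfl
    rfl

lemma measureReal_eq_sum_single {Ω : Type*} {mΩ : MeasurableSpace Ω} (μ : Measure Ω)
    [IsFiniteMeasure μ] {N : ℕ} {Y : Ω → Fin N → ℝ} (hY : Measurable Y)
    (hYval : ∀ ω, ∃ i, Y ω = Pi.single i 1) {S : Set Ω} (hS : MeasurableSet S) :
    μ.real S = ∑ j, μ.real (S ∩ {ω | Y ω = Pi.single j 1}) := by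
  rw [← measureReal_biUnion_finset]
  · congr 1
    ext ω
    simpa using fun _ => hYval ω
  · intro i _ j _ hij
    refine Set.disjoint_left.mpr ?_
    rintro ω ⟨-, hi⟩ ⟨-, hj⟩
    exact hij (single_one_inj.mp ((show Y ω = _ from hi).symm.trans hj))
  · exact fun j _ => hS.inter (hY (measurableSet_singleton _))

section Chain

variable {Ω : Type} {mΩ : MeasurableSpace Ω} {μ : Measure Ω} {N : ℕ}
  {X : ℕ → Ω → (Fin N → ℝ)} {F : ℕ → MeasurableSpace Ω} {τ : ℕ → Ω → ℕ∞}
  {q : Fin N → Fin N → ℕ → ℝ} {π Fs : Fin N → ℕ → ℝ}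

lemma measurable_of_le_history
    (hF : ∀ k, F k = ⨆ j ∈ Finset.range (k + 1), MeasurableSpace.comap (X j) inferInstance)
    {j k : ℕ} (hjk : j ≤ k) : Measurable[F k] (X j) := by
  rw [hF, measurable_iff_comap_le]
  exact le_iSup₂_of_le j (Finset.mem_range.mpr (by omega)) le_rfl

lemma history_le (hXmeas : ∀ k, Measurable (X k))
    (hF : ∀ k, F k = ⨆ j ∈ Finset.range (k + 1), MeasurableSpace.comap (X j) inferInstance)
    (k : ℕ) : F k ≤ mΩ := by
  rw [hF]
  exact iSup₂_le fun j _ => (hXmeas j).comap_le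

lemma measurableSet_constFrom {m₀ : MeasurableSpace Ω} {s m : ℕ}
    (hX : ∀ k < s + m, Measurable[m₀] (X k)) :
    MeasurableSet[m₀] {ω | ConstFrom (X · ω) s m} := by
  have : {ω | ConstFrom (X · ω) s m} = ⋂ l, ⋂ (_ : l < m), {ω | X (s + l) ω = X s ω} := by
    ext ω
    simp [ConstFrom]
  rw [this]
  exact MeasurableSet.iInter fun l => MeasurableSet.iInter fun hl =>
    measurableSet_eq_fun (hX _ (by omega)) (hX _ (by omega))

lemma measurableSet_isJumpTime {m₀ : MeasurableSpace Ω} {s : ℕ}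
    (hX : ∀ k ≤ s, Measurable[m₀] (X k)) :
    MeasurableSet[m₀] {ω | IsJumpTime (X · ω) s} := by
  have : {ω | IsJumpTime (X · ω) s} = ⋂ r, ⋂ (_ : s = r + 1), {ω | X s ω = X r ω}ᶜ := by
    ext ω
    simp [IsJumpTime]
  rw [this]
  exact MeasurableSet.iInter fun r => MeasurableSet.iInter fun hr =>
    (measurableSet_eq_fun (hX _ le_rfl) (hX _ (by omega))).compl

lemma measurableSet_jump_eq
    (hF : ∀ k, F k = ⨆ j ∈ Finset.range (k + 1), MeasurableSpace.comap (X j) inferInstance)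
    (hτ0 : ∀ ω, τ 0 ω = 0)
    (hτrec : ∀ m ω, τ (m + 1) ω = sInf ((fun k : ℕ => (k : ℕ∞)) ''
        {k : ℕ | τ m ω < (k : ℕ∞) ∧ X k ω ≠ X (τ m ω).toNat ω}))
    (n : ℕ) : ∀ k : ℕ, MeasurableSet[F k] {ω | τ n ω = k} := by
  have hmono : Monotone F := by
    intro a b hab
    rw [hF, hF]
    exact biSup_mono fun j hj => Finset.mem_range.mpr
      ((Finset.mem_range.mp hj).trans_le (by omega))
  induction n with
  | zero =>
    intro k
    simp only [hτ0]
    exact MeasurableSet.const _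
  | succ n ih =>
    intro k
    have : {ω | τ (n + 1) ω = k} = ⋃ r, ⋃ (_ : r < k), {ω | τ n ω = r} ∩
        ({ω | ConstFrom (X · ω) r (k - r)} ∩ {ω | X k ω = X r ω}ᶜ) := by
      ext ω
      simp only [Set.mem_ofPred_eq, Set.mem_iUnion, exists_prop]
      exact jump_succ_eq_iff_exists (x := (X · ω)) (t := (τ · ω)) (fun n => hτrec n ω)
    rw [this]
    refine MeasurableSet.iUnion fun r => MeasurableSet.iUnion fun hr =>
      (hmono hr.le _ (ih r)).inter (MeasurableSet.inter ?_ (MeasurableSet.compl ?_))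
    · exact measurableSet_constFrom fun j hj => measurable_of_le_history hF (by omega)
    · exact measurableSet_eq_fun (measurable_of_le_history hF le_rfl)
        (measurable_of_le_history hF hr.le)

/-- Before the next jump after `s`, the history carries no more information than at `s`. -/
lemma exists_history_eq_of_constFrom
    (hF : ∀ k, F k = ⨆ j ∈ Finset.range (k + 1), MeasurableSpace.comap (X j) inferInstance)
    {k s m : ℕ} (hm : 1 ≤ m) (hsm : s + m = k + 1) {B : Set Ω} (hB : MeasurableSet[F k] B) :
    ∃ A, MeasurableSet[F s] A ∧ ∀ ω, ConstFrom (X · ω) s m → (ω ∈ B ↔ ω ∈ A) := by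
  let Z : ℕ → Ω → ℕ → Fin N → ℝ := fun a ω j => X (min j a) ω
  have hle : F k ≤ MeasurableSpace.comap (Z k) inferInstance := by
    rw [hF]
    refine iSup₂_le fun j hj => ?_
    have hj' : j ≤ k := Nat.lt_succ_iff.mp (Finset.mem_range.mp hj)
    have : X j = (fun z : ℕ → Fin N → ℝ => z j) ∘ Z k := by
      ext ω
      simp [Z, hj']
    rw [this, ← MeasurableSpace.comap_comp]
    exact MeasurableSpace.comap_mono (measurable_pi_apply j).comap_le
  obtain ⟨B', hB', rfl⟩ := hle _ hB
  have hZ : Measurable[F s] (Z s) :=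
    @measurable_pi_lambda Ω ℕ _ (F s) _ _ fun j => measurable_of_le_history hF (min_le_right j s)
  refine ⟨Z s ⁻¹' B', hZ hB', fun ω hω => ?_⟩
  have : Z k ω = Z s ω := by
    funext j
    change X (min j k) ω = X (min j s) ω
    rcases le_total j s with hj | hj
    · rw [min_eq_left hj, min_eq_left (by omega)]
    · rw [min_eq_right hj]
      have := hω (min j k - s) (by omega)
      rwa [show s + (min j k - s) = min j k by omega] at this
  rw [Set.mem_preimage, Set.mem_preimage, this]

lemma measurable_sojourn {m₀ : MeasurableSpace Ω} {h : ℕ → Ω → ℕ} (hh0 : ∀ ω, h 0 ω = 1)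
    (hhrec : ∀ k ω, h (k + 1) ω = if X (k + 1) ω = X k ω then h k ω + 1 else 1) {k : ℕ}
    (hX : ∀ j ≤ k, Measurable[m₀] (X j)) : Measurable[m₀] (h k) := by
  induction k with
  | zero =>
    rw [show h 0 = fun _ => 1 from funext hh0]
    exact measurable_const
  | succ k ih =>
    rw [show h (k + 1) = fun ω => if X (k + 1) ω = X k ω then h k ω + 1 else 1 from
      funext (hhrec k)]
    exact Measurable.ite (measurableSet_eq_fun (hX _ le_rfl) (hX _ (by omega)))
      ((ih fun j hj => hX j (by omega)).add_const 1) measurable_const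

variable (hXmeas : ∀ k, Measurable (X k))
    (hXval : ∀ k ω, ∃ i, X k ω = Pi.single i 1)
    (hF : ∀ k, F k = ⨆ j ∈ Finset.range (k + 1), MeasurableSpace.comap (X j) inferInstance)
    (hτ0 : ∀ ω, τ 0 ω = 0)
    (hτrec : ∀ m ω, τ (m + 1) ω = sInf ((fun k : ℕ => (k : ℕ∞)) ''
        {k : ℕ | τ m ω < (k : ℕ∞) ∧ X k ω ≠ X (τ m ω).toNat ω}))
    (hq01 : ∀ j i m, 0 ≤ q j i m ∧ q j i m ≤ 1)
    (hqdiag : ∀ i m, q i i m = 0)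
    (hSM : ∀ (nn : ℕ) (i j : Fin N) (m : ℕ), 1 ≤ m → ∀ A : Set Ω,
      (MeasurableSet A ∧ ∀ k : ℕ, MeasurableSet[F k] (A ∩ {ω | τ nn ω = (k : ℕ∞)})) →
      μ (A ∩ {ω | τ nn ω ≠ ⊤ ∧ X (τ nn ω).toNat ω = Pi.single i 1
            ∧ τ (nn + 1) ω = τ nn ω + (m : ℕ∞)
            ∧ X (τ (nn + 1) ω).toNat ω = Pi.single j 1})
        = ENNReal.ofReal (q j i m)
            * μ (A ∩ {ω | τ nn ω ≠ ⊤ ∧ X (τ nn ω).toNat ω = Pi.single i 1}))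
    (hπ : ∀ i m, π i m = ∑ j, q j i m)
    (hFs : ∀ i m, Fs i m = 1 - ∑ l ∈ Finset.Icc 1 m, π i l)

include hXmeas hF hτ0 hτrec hSM

lemma measure_jump_at_inter {s n m : ℕ} (hm : 1 ≤ m) {i j : Fin N} (hij : j ≠ i) {A : Set Ω}
    (hA : MeasurableSet[F s] A) :
    μ ((A ∩ {ω | τ n ω = s}) ∩
        {ω | X s ω = Pi.single i 1 ∧ ConstFrom (X · ω) s m ∧ X (s + m) ω = Pi.single j 1}) =
      ENNReal.ofReal (q j i m) * μ ((A ∩ {ω | τ n ω = s}) ∩ {ω | X s ω = Pi.single i 1}) := by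
  have hτm := measurableSet_jump_eq hF hτ0 hτrec n s
  have key := hSM n i j m hm (A ∩ {ω | τ n ω = s}) ⟨history_le hXmeas hF s _ (hA.inter hτm), by
    intro k
    by_cases hk : k = s
    · subst hk
      exact (hA.inter hτm).inter hτm
    · convert MeasurableSet.empty using 1
      ext ω
      simp only [Set.mem_inter_iff, Set.mem_ofPred_eq, Set.mem_empty_iff_false, iff_false]
      rintro ⟨⟨-, h1⟩, h2⟩
      rw [h1] at h2
      exact hk (by exact_mod_cast h2.symm)⟩
  convert key using 2
  · ext ω
    simp only [Set.mem_inter_iff, Set.mem_ofPred_eq]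
    refine and_congr_right fun ⟨_, hs⟩ => ?_
    have h1 := jump_succ_eq_iff (x := (X · ω)) (t := (τ · ω)) (fun n => hτrec n ω) hs hm
    simp only [hs, ENat.toNat_natCast] at h1 ⊢
    rw [← Nat.cast_add]
    constructor
    · rintro ⟨h2, h3, h4⟩
      have h5 := h1.mpr ⟨h3, by rw [h2, h4]; exact fun he => hij (single_one_inj.mp he)⟩
      exact ⟨ENat.natCast_ne_top _, h2, h5, by rw [h5]; exact h4⟩
    · rintro ⟨-, h2, h3, h4⟩
      rw [h3] at h4
      exact ⟨h2, (h1.mp h3).1, h4⟩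
  · congr 1
    ext ω
    simp only [Set.mem_inter_iff, Set.mem_ofPred_eq]
    refine and_congr_right fun ⟨_, hs⟩ => ?_
    simp [hs]

lemma measureReal_jump_inter {s m : ℕ} (hm : 1 ≤ m) {i j : Fin N} (hij : j ≠ i) {A : Set Ω}
    (hq : 0 ≤ q j i m) (hA : MeasurableSet[F s] A) :
    μ.real (A ∩ {ω | IsJumpTime (X · ω) s ∧ X s ω = Pi.single i 1} ∩
        {ω | ConstFrom (X · ω) s m} ∩ {ω | X (s + m) ω = Pi.single j 1}) =
      q j i m * μ.real (A ∩ {ω | IsJumpTime (X · ω) s ∧ X s ω = Pi.single i 1}) := by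
  have hJ : ∀ ω, IsJumpTime (X · ω) s ↔ ∃ n, τ n ω = s := fun ω =>
    isJumpTime_iff (x := (X · ω)) (t := (τ · ω)) (fun n => hτrec n ω) (hτ0 ω) s
  have hle := history_le hXmeas hF s
  have hmeas : ∀ n, MeasurableSet (A ∩ {ω | τ n ω = s}) := fun n =>
    hle _ (hA.inter (measurableSet_jump_eq hF hτ0 hτrec n s))
  have hdisj : ∀ D : Set Ω,
      Pairwise (Function.onFun Disjoint fun n => (A ∩ {ω | τ n ω = s}) ∩ D) := by
    intro D n n' hne
    refine Set.disjoint_left.mpr ?_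
    rintro ω ⟨⟨-, h1⟩, -⟩ ⟨⟨-, h2⟩, -⟩
    exact hne (jump_injective (x := (X · ω)) (t := (τ · ω)) (fun n => hτrec n ω) h1 h2)
  have hXs : ∀ (k : ℕ) (i : Fin N), MeasurableSet {ω | X k ω = Pi.single i 1} := fun k i =>
    hXmeas k (measurableSet_singleton _)
  have e1 : A ∩ {ω | IsJumpTime (X · ω) s ∧ X s ω = Pi.single i 1} ∩
        {ω | ConstFrom (X · ω) s m} ∩ {ω | X (s + m) ω = Pi.single j 1} =
      ⋃ n, (A ∩ {ω | τ n ω = s}) ∩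
        {ω | X s ω = Pi.single i 1 ∧ ConstFrom (X · ω) s m ∧ X (s + m) ω = Pi.single j 1} := by
    ext ω
    simp only [Set.mem_inter_iff, Set.mem_ofPred_eq, Set.mem_iUnion, hJ]
    tauto
  have e2 : A ∩ {ω | IsJumpTime (X · ω) s ∧ X s ω = Pi.single i 1} =
      ⋃ n, (A ∩ {ω | τ n ω = s}) ∩ {ω | X s ω = Pi.single i 1} := by
    ext ω
    simp only [Set.mem_inter_iff, Set.mem_ofPred_eq, Set.mem_iUnion, hJ]
    tauto
  rw [e1, e2, Measure.real, Measure.real, measure_iUnion (hdisj _), measure_iUnion (hdisj _)]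
  · simp only [measure_jump_at_inter hXmeas hF hτ0 hτrec hSM hm hij hA]
    rw [ENNReal.tsum_mul_left, ENNReal.toReal_mul, ENNReal.toReal_ofReal hq]
  · exact fun n => (hmeas n).inter (hXs s i)
  · exact fun n => (hmeas n).inter ((hXs s i).inter
      ((measurableSet_constFrom fun k _ => hXmeas k).inter (hXs (s + m) j)))

variable [IsProbabilityMeasure μ]

include hXval hq01 hqdiag hπ hFs

lemma measureReal_constFrom {s : ℕ} {i : Fin N} {A : Set Ω} (hA : MeasurableSet[F s] A) (m : ℕ) :
    μ.real (A ∩ {ω | IsJumpTime (X · ω) s ∧ X s ω = Pi.single i 1} ∩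
        {ω | ConstFrom (X · ω) s (m + 1)}) =
      Fs i m * μ.real (A ∩ {ω | IsJumpTime (X · ω) s ∧ X s ω = Pi.single i 1}) := by
  set D := A ∩ {ω | IsJumpTime (X · ω) s ∧ X s ω = Pi.single i 1} with hD
  have hDm : MeasurableSet D := (history_le hXmeas hF s _ hA).inter
    ((measurableSet_isJumpTime fun k _ => hXmeas k).inter (hXmeas s (measurableSet_singleton _)))
  induction m with
  | zero =>
    have : D ∩ {ω | ConstFrom (X · ω) s (0 + 1)} = D := by
      ext ω
      simpa using fun _ => constFrom_one s
    rw [this, hFs]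
    simp
  | succ m ih =>
    rw [measureReal_eq_sum_single μ (hXmeas (s + (m + 1))) (hXval _)
      (hDm.inter (measurableSet_constFrom fun k _ => hXmeas k)),
      ← Finset.add_sum_erase _ _ (Finset.mem_univ i)] at ih
    have e1 : D ∩ {ω | ConstFrom (X · ω) s (m + 1)} ∩ {ω | X (s + (m + 1)) ω = Pi.single i 1} =
        D ∩ {ω | ConstFrom (X · ω) s (m + 1 + 1)} := by
      ext ω
      simp only [Set.mem_inter_iff, Set.mem_ofPred_eq, constFrom_succ (m := m + 1), and_assoc]
      refine and_congr_right fun h1 => ?_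
      rw [h1.2.2]
    have e2 : ∀ j ∈ Finset.univ.erase i, μ.real (D ∩ {ω | ConstFrom (X · ω) s (m + 1)} ∩
        {ω | X (s + (m + 1)) ω = Pi.single j 1}) = q j i (m + 1) * μ.real D := fun j hj =>
      measureReal_jump_inter hXmeas hF hτ0 hτrec hSM (by omega) (Finset.ne_of_mem_erase hj)
        (hq01 _ _ _).1 hA
    have e3 : ∑ j ∈ Finset.univ.erase i, q j i (m + 1) = π i (m + 1) := by
      rw [hπ, ← Finset.add_sum_erase _ _ (Finset.mem_univ i), hqdiag, zero_add]
    have e4 : Fs i (m + 1) = Fs i m - π i (m + 1) := by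
      rw [hFs, hFs, Finset.sum_Icc_succ_top (by omega)]
      ring
    rw [e1, Finset.sum_congr rfl e2, ← Finset.sum_mul, e3] at ih
    rw [e4, sub_mul, ← ih]
    ring

variable {h : ℕ → Ω → ℕ} (hh0 : ∀ ω, h 0 ω = 1)
    (hhrec : ∀ k ω, h (k + 1) ω = if X (k + 1) ω = X k ω then h k ω + 1 else 1)

include hh0 hhrec

lemma measureReal_sojourn_jump {k b : ℕ} {i j : Fin N} (hij : j ≠ i) {B : Set Ω}
    (hB : MeasurableSet[F k] B) :
    Fs i b * μ.real (B ∩ {ω | X k ω = Pi.single i 1 ∧ h k ω = b + 1} ∩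
        {ω | X (k + 1) ω = Pi.single j 1}) =
      q j i (b + 1) * μ.real (B ∩ {ω | X k ω = Pi.single i 1 ∧ h k ω = b + 1}) := by
  by_cases hbk : k < b
  · have : B ∩ {ω | X k ω = Pi.single i 1 ∧ h k ω = b + 1} = ∅ := by
      ext ω
      have := (sojourn_le (x := (X · ω)) (c := (h · ω)) (hh0 ω) (fun k => hhrec k ω) k).2
      simp only [Set.mem_inter_iff, Set.mem_ofPred_eq, Set.mem_empty_iff_false, iff_false]
      omega
    simp [this]
  obtain ⟨s, rfl⟩ : ∃ s, k = s + b := ⟨k - b, by omega⟩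
  obtain ⟨A, hA, hAB⟩ := exists_history_eq_of_constFrom hF (s := s) (m := b + 1) (by omega) rfl hB
  have e : B ∩ {ω | X (s + b) ω = Pi.single i 1 ∧ h (s + b) ω = b + 1} =
      A ∩ {ω | IsJumpTime (X · ω) s ∧ X s ω = Pi.single i 1} ∩
        {ω | ConstFrom (X · ω) s (b + 1)} := by
    ext ω
    have h1 := sojourn_eq_iff (x := (X · ω)) (c := (h · ω)) (hh0 ω) (fun k => hhrec k ω) (s + b)
      s (b + 1) (by omega) rfl
    have h2 := hAB ω
    simp only [Set.mem_inter_iff, Set.mem_ofPred_eq, h1]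
    constructor
    · rintro ⟨h3, h4, h5, h6⟩
      exact ⟨⟨(h2 h6).mp h3, h5, (h6 b (by omega)).symm.trans h4⟩, h6⟩
    · rintro ⟨⟨h3, h5, h4⟩, h6⟩
      exact ⟨(h2 h6).mpr h3, (h6 b (by omega)).trans h4, h5, h6⟩
  rw [e, measureReal_constFrom hXmeas hXval hF hτ0 hτrec hq01 hqdiag hSM hπ hFs hA,
    add_assoc s b 1, measureReal_jump_inter hXmeas hF hτ0 hτrec hSM (by omega) hij
      (hq01 _ _ _).1 hA]
  ring

variable {Δ : Fin N → ℕ → ℝ} {p : Fin N → Fin N → ℕ → ℝ} (hFspos : ∀ i m, 0 < Fs i m)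
  (hΔ : ∀ i m, Δ i m = π i m / Fs i (m - 1))
  (hp : ∀ j i m, p j i m = if 0 < π i m then q j i m / π i m else 0)

include hFspos hΔ hp

lemma measureReal_lattice_transition {k b b' : ℕ} {i j : Fin N} {B : Set Ω}
    (hB : MeasurableSet[F k] B) :
    μ.real (B ∩ {ω | X k ω = Pi.single i 1 ∧ h k ω = b + 1} ∩
        {ω | X (k + 1) ω = Pi.single j 1 ∧ h (k + 1) ω = b' + 1}) =
      (if b' = 0 ∧ j ≠ i then p j i (b + 1) * Δ i (b + 1)
        else if j = i ∧ b' = b + 1 then 1 - Δ i (b + 1) else 0) *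
      μ.real (B ∩ {ω | X k ω = Pi.single i 1 ∧ h k ω = b + 1}) := by
  set D := B ∩ {ω | X k ω = Pi.single i 1 ∧ h k ω = b + 1} with hD
  have hjump : ∀ j ≠ i, μ.real (D ∩ {ω | X (k + 1) ω = Pi.single j 1}) =
      q j i (b + 1) / Fs i b * μ.real D := by
    intro j hj
    have := measureReal_sojourn_jump hXmeas hXval hF hτ0 hτrec hq01 hqdiag hSM hπ hFs hh0 hhrec
      (b := b) hj hB
    have hpos := (hFspos i b).ne'
    field_simp
    linarith
  have hh : ∀ ω ∈ D, X (k + 1) ω = Pi.single j 1 →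
      h (k + 1) ω = if j = i then b + 2 else 1 := by
    rintro ω ⟨-, h1, h2⟩ h3
    rw [hhrec, h1, h2, h3]
    simp only [single_one_inj]
  have hset : D ∩ {ω | X (k + 1) ω = Pi.single j 1 ∧ h (k + 1) ω = b' + 1} =
      if (if j = i then b + 2 else 1) = b' + 1 then D ∩ {ω | X (k + 1) ω = Pi.single j 1}
      else ∅ := by
    ext ω
    have := hh ω
    by_cases hc : (if j = i then b + 2 else 1) = b' + 1
    · rw [if_pos hc]
      exact ⟨fun ⟨h1, h2, _⟩ => ⟨h1, h2⟩, fun ⟨h1, h2⟩ => ⟨h1, h2, (this h1 h2).trans hc⟩⟩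
    · rw [if_neg hc]
      exact ⟨fun ⟨h1, h2, h3⟩ => hc ((this h1 h2).symm.trans h3), fun h1 => h1.elim⟩
  rw [hset]
  by_cases hji : j = i
  · subst hji
    by_cases hb : b' = b + 1
    · subst hb
      have hDm : MeasurableSet D := (history_le hXmeas hF k _ hB).inter
        ((hXmeas k (measurableSet_singleton _)).inter
          (measurable_sojourn hh0 hhrec (fun k _ => hXmeas k) (measurableSet_singleton _)))
      have hsum := measureReal_eq_sum_single μ (hXmeas (k + 1)) (hXval _) hDm
      rw [← Finset.add_sum_erase _ _ (Finset.mem_univ j),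
        Finset.sum_congr rfl fun l hl => hjump l (Finset.ne_of_mem_erase hl), ← Finset.sum_mul,
        ← Finset.sum_div] at hsum
      have hπ' : ∑ l ∈ Finset.univ.erase j, q l j (b + 1) = π j (b + 1) := by
        rw [hπ, ← Finset.add_sum_erase _ _ (Finset.mem_univ j), hqdiag, zero_add]
      rw [hπ'] at hsum
      simp only [if_true, ne_eq, not_true_eq_false, and_false, if_false, and_self, hΔ,
        Nat.add_sub_cancel]
      linarith
    · have : ¬ b + 2 = b' + 1 := by omega
      simp [hb, this]
  · by_cases hb : b' = 0
    · subst hb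
      have hpΔ : p j i (b + 1) * Δ i (b + 1) = q j i (b + 1) / Fs i b := by
        rw [hp, hΔ, Nat.add_sub_cancel]
        split_ifs with hpos
        · field_simp
        · have hle : q j i (b + 1) ≤ π i (b + 1) := by
            rw [hπ]
            exact Finset.single_le_sum (f := fun j => q j i (b + 1))
              (fun l _ => (hq01 l i (b + 1)).1) (Finset.mem_univ j)
          have : q j i (b + 1) = 0 := by
            have := (hq01 j i (b + 1)).1
            linarith
          simp [this]
      simp [hji, hpΔ, hjump j hji]
    · have : ¬ 1 = b' + 1 := by omega
      simp [hji, hb]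

end Chain

/-- For every `0 ≤ k ≤ T−1`, `E[X̄_{k+1} ∣ ℱ_k] = C X̄_k` almost surely;
equivalently `X̄_{k+1} = C X̄_k + M̄_{k+1}` with `E[M̄_{k+1} ∣ ℱ_k] = 0` a.s. -/
theorem statement2
    {Ω : Type} {mΩ : MeasurableSpace Ω} (μ : Measure Ω) [IsProbabilityMeasure μ]
    (N : ℕ) (hN : 1 ≤ N)
    (X : ℕ → Ω → (Fin N → ℝ))
    (hXmeas : ∀ k, Measurable (X k))
    (hXval : ∀ k ω, ∃ i, X k ω = Pi.single i 1)
    (F : ℕ → MeasurableSpace Ω)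
    (hF : ∀ k, F k = ⨆ j ∈ Finset.range (k + 1), MeasurableSpace.comap (X j) inferInstance)
    (τ : ℕ → Ω → ℕ∞)
    (hτ0 : ∀ ω, τ 0 ω = 0)
    (hτrec : ∀ m ω, τ (m + 1) ω =
      sInf ((fun k : ℕ => (k : ℕ∞)) ''
        {k : ℕ | τ m ω < (k : ℕ∞) ∧ X k ω ≠ X (τ m ω).toNat ω}))
    (h : ℕ → Ω → ℕ)
    (hh0 : ∀ ω, h 0 ω = 1)
    (hhrec : ∀ k ω, h (k + 1) ω = if X (k + 1) ω = X k ω then h k ω + 1 else 1)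
    (q : Fin N → Fin N → ℕ → ℝ)
    (hq01 : ∀ j i m, 0 ≤ q j i m ∧ q j i m ≤ 1)
    (hqdiag : ∀ i m, q i i m = 0)
    (hSM : ∀ (nn : ℕ) (i j : Fin N) (m : ℕ), 1 ≤ m → ∀ A : Set Ω,
      (MeasurableSet A ∧ ∀ k : ℕ, MeasurableSet[F k] (A ∩ {ω | τ nn ω = (k : ℕ∞)})) →
      μ (A ∩ {ω | τ nn ω ≠ ⊤ ∧ X (τ nn ω).toNat ω = Pi.single i 1
            ∧ τ (nn + 1) ω = τ nn ω + (m : ℕ∞)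
            ∧ X (τ (nn + 1) ω).toNat ω = Pi.single j 1})
        = ENNReal.ofReal (q j i m)
            * μ (A ∩ {ω | τ nn ω ≠ ⊤ ∧ X (τ nn ω).toNat ω = Pi.single i 1}))
    (π : Fin N → ℕ → ℝ) (hπ : ∀ i m, π i m = ∑ j, q j i m)
    (Fs : Fin N → ℕ → ℝ)
    (hFs : ∀ i m, Fs i m = 1 - ∑ l ∈ Finset.Icc 1 m, π i l)
    (hFspos : ∀ i m, 0 < Fs i m)
    (Δ : Fin N → ℕ → ℝ) (hΔ : ∀ i m, Δ i m = π i m / Fs i (m - 1))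
    (p : Fin N → Fin N → ℕ → ℝ)
    (hp : ∀ j i m, p j i m = if 0 < π i m then q j i m / π i m else 0)
    -- finite horizon and the lattice process
    (T : ℕ) (hT : 1 ≤ T)
    (Xb : ℕ → Ω → (Fin (T + 1) × Fin N → ℝ))
    (hXb : ∀ k ω (ml : Fin (T + 1) × Fin N),
      Xb k ω ml = if X k ω = Pi.single ml.2 1 ∧ h k ω = (ml.1 : ℕ) + 1 then 1 else 0)
    -- the lattice transition matrix `C`
    (Cm : Matrix (Fin (T + 1) × Fin N) (Fin (T + 1) × Fin N) ℝ)
    (hCm : ∀ (b b' : Fin (T + 1)) (i j : Fin N),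
      Cm (b', j) (b, i) =
        if b' = (0 : Fin (T + 1)) ∧ j ≠ i then p j i ((b : ℕ) + 1) * Δ i ((b : ℕ) + 1)
        else if j = i ∧ (b' : ℕ) = (b : ℕ) + 1 then 1 - Δ i ((b : ℕ) + 1)
        else 0) :
    ∀ k : ℕ, k < T → ∀ rc : Fin (T + 1) × Fin N,
      ((μ[(fun ω => Xb (k + 1) ω rc) | F k]) =ᵐ[μ] fun ω => (Cm *ᵥ Xb k ω) rc)
      ∧ ((μ[(fun ω => Xb (k + 1) ω rc - (Cm *ᵥ Xb k ω) rc) | F k]) =ᵐ[μ] 0) := by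
  classical
  intro k hk rc
  obtain ⟨b', j⟩ := rc
  have hFle := history_le hXmeas hF k
  have hXbm : ∀ (m₀ : MeasurableSpace Ω) (k : ℕ), (∀ j ≤ k, Measurable[m₀] (X j)) →
      ∀ ml, Measurable[m₀] fun ω => Xb k ω ml := by
    intro m₀ k hX ml
    simp only [hXb]
    exact Measurable.ite ((hX k le_rfl (measurableSet_singleton _)).inter
      (measurable_sojourn hh0 hhrec hX (measurableSet_singleton _))) measurable_const
      measurable_const
  have hXbi : ∀ k ml, Integrable (fun ω => Xb k ω ml) μ := by
    intro k ml
    refine Integrable.of_bound (C := 1)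
      (hXbm mΩ k (fun k _ => hXmeas k) ml).aestronglyMeasurable (ae_of_all _ fun ω => ?_)
    rw [hXb]
    split_ifs <;> simp
  have hCi : Integrable (fun ω => (Cm *ᵥ Xb k ω) (b', j)) μ := by
    simp only [Matrix.mulVec, dotProduct]
    exact integrable_finsetSum _ fun bi _ => (hXbi k bi).const_mul _
  have hCm' : StronglyMeasurable[F k] fun ω => (Cm *ᵥ Xb k ω) (b', j) := by
    simp only [Matrix.mulVec, dotProduct]
    exact (Finset.measurable_fun_sum _ fun bi _ => (hXbm (F k) k
      (fun j hj => measurable_of_le_history hF hj) bi).const_mul _).stronglyMeasurable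
  let E : ℕ → Fin (T + 1) × Fin N → Set Ω := fun k ml =>
    {ω | X k ω = Pi.single ml.2 1 ∧ h k ω = (ml.1 : ℕ) + 1}
  have hE : ∀ k ml, MeasurableSet (E k ml) := fun k ml =>
    (hXmeas k (measurableSet_singleton _)).inter
      (measurable_sojourn hh0 hhrec (fun k _ => hXmeas k) (measurableSet_singleton _))
  have hXbE : ∀ k ml, (fun ω => Xb k ω ml) = (E k ml).indicator fun _ => (1 : ℝ) := by
    intro k ml
    funext ω
    rw [hXb, Set.indicator_apply]
    rfl
  have hsetInt : ∀ k ml B, MeasurableSet B → ∫ ω in B, Xb k ω ml ∂μ = μ.real (B ∩ E k ml) := by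
    intro k ml B hB
    rw [hXbE, integral_indicator (hE k ml), setIntegral_const, smul_eq_mul, mul_one,
      measureReal_restrict_apply (hE k ml), Set.inter_comm]
  have hmain : (fun ω => (Cm *ᵥ Xb k ω) (b', j)) =ᵐ[μ]
      μ[(fun ω => Xb (k + 1) ω (b', j)) | F k] := by
    refine ae_eq_condExp_of_forall_setIntegral_eq hFle (hXbi _ _) (fun _ _ _ => hCi.integrableOn)
      (fun B hB _ => ?_) hCm'.aestronglyMeasurable
    have hBm := hFle _ hB
    simp only [Matrix.mulVec, dotProduct]
    rw [integral_finsetSum _ fun bi _ => ((hXbi k bi).const_mul _).integrableOn,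
      hsetInt _ _ _ hBm]
    simp only [integral_const_mul, hsetInt _ _ _ hBm]
    have hpart : μ.real (B ∩ E (k + 1) (b', j)) =
        ∑ bi, μ.real (B ∩ E k bi ∩ E (k + 1) (b', j)) := by
      rw [← measureReal_biUnion_finset]
      · congr 1
        ext ω
        simp only [Set.mem_inter_iff, Set.mem_iUnion, Finset.mem_univ, exists_prop, true_and]
        refine ⟨fun ⟨h1, h2⟩ => ?_, fun ⟨_, ⟨h1, _⟩, h2⟩ => ⟨h1, h2⟩⟩
        obtain ⟨i, hi⟩ := hXval k ω
        have hb := sojourn_le (x := (X · ω)) (c := (h · ω)) (hh0 ω) (fun k => hhrec k ω) k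
        exact ⟨(⟨h k ω - 1, by omega⟩, i), ⟨h1, hi, (Nat.sub_add_cancel hb.1).symm⟩, h2⟩
      · rintro ⟨b₁, i₁⟩ _ ⟨b₂, i₂⟩ _ hne
        refine Set.disjoint_left.mpr ?_
        rintro ω ⟨⟨-, h1, h2⟩, -⟩ ⟨⟨-, h3, h4⟩, -⟩
        apply hne
        have hb : (b₁ : ℕ) = b₂ := Nat.succ_injective (h2.symm.trans h4)
        exact Prod.ext (Fin.ext hb) (single_one_inj.mp (h1.symm.trans h3))
      · exact fun bi _ => (hBm.inter (hE _ _)).inter (hE _ _)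
    rw [hpart]
    refine Finset.sum_congr rfl fun bi _ => ?_
    obtain ⟨b, i⟩ := bi
    have := measureReal_lattice_transition hXmeas hXval hF hτ0 hτrec hq01 hqdiag hSM hπ hFs hh0
      hhrec hFspos hΔ hp (b := b) (b' := b') (i := i) (j := j) hB
    rw [hCm]
    simp only [← Fin.val_eq_zero_iff]
    exact this.symm
  refine ⟨hmain.symm, ?_⟩
  refine (condExp_sub (hXbi (k + 1) (b', j)) hCi (F k)).trans ?_
  rw [condExp_of_stronglyMeasurable hFle hCm' hCi]
  filter_upwards [hmain] with ω hω
  simp [← hω]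
end

section
/- The backward stochastic difference equation Y_i = Q + Σ_{u=i}^{T−1} f(u, Y_u, Z_u) − Σ_{u=i}^{T−1} Z_u M̄_{u+1} (i = 0,…,T−1), Y_T = Q, has an adapted solution (Y, Z), with Y_i real-valued and Z_i ∈ ℝ^{1×n} both ℱ_i-measurable; moreover this solution is unique in the following sense: the Y-component is unique up to indistinguishability (P-a.s. equality for each i), and for each i the Z-component is unique up to the equivalence Z_i^{(1)} ∼ Z_i^{(2)} defined by Z_i^{(1)} M̄_{i+1} = Z_i^{(2)} M̄_{i+1} P-a.s. -/
open MeasureTheory Matrix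
open scoped ENNReal

/-- The common setting of Sections 3–5: a finite-horizon Markov chain `X̄` on the
standard unit vectors of `ℝ^n` with column-stochastic transition matrix `C`
(arising from the lattice representation of a semi-Markov chain), its martingale
increments `M̄`, the conditional covariance matrices `Ψ_k` and their
Moore–Penrose pseudoinverses `Ψ_k†`. -/
structure SMCSetup (Ω : Type) [mΩ : MeasurableSpace Ω] (μ : MeasureTheory.Measure Ω)
    (T n : ℕ) where
  C : Matrix (Fin n) (Fin n) ℝ
  Xbar : ℕ → Ω → (Fin n → ℝ)
  F : ℕ → MeasurableSpace Ω
  Mbar : ℕ → Ω → (Fin n → ℝ)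
  Psi : ℕ → Ω → Matrix (Fin n) (Fin n) ℝ
  Psid : ℕ → Ω → Matrix (Fin n) (Fin n) ℝ
  hT : 1 ≤ T
  hn : 1 ≤ n
  hCnonneg : ∀ i j, 0 ≤ C i j
  hCcol : ∀ i, ∑ j, C j i = 1
  hXmeas : ∀ k, Measurable (Xbar k)
  hXval : ∀ k ω, ∃ i, Xbar k ω = Pi.single i 1
  hX0 : ∃ x0, ∀ ω, Xbar 0 ω = x0
  hF : ∀ k, F k = ⨆ j ∈ Finset.range (k + 1), MeasurableSpace.comap (Xbar j) inferInstance
  hMarkov : ∀ k, k < T → ∀ i j : Fin n, ∀ A : Set Ω, MeasurableSet[F k] A →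
    μ (A ∩ {ω | Xbar (k + 1) ω = Pi.single j 1} ∩ {ω | Xbar k ω = Pi.single i 1})
      = ENNReal.ofReal (C j i) * μ (A ∩ {ω | Xbar k ω = Pi.single i 1})
  hMbar : ∀ k ω, Mbar (k + 1) ω = Xbar (k + 1) ω - C *ᵥ Xbar k ω
  hPsi : ∀ k a b, (fun ω => Psi k ω a b)
      = μ[(fun ω => Mbar (k + 1) ω a * Mbar (k + 1) ω b) | F k]
  hMP1 : ∀ k ω, Psi k ω * Psid k ω * Psi k ω = Psi k ω
  hMP2 : ∀ k ω, Psid k ω * Psi k ω * Psid k ω = Psid k ω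
  hMP3 : ∀ k ω, (Psi k ω * Psid k ω)ᵀ = Psi k ω * Psid k ω
  hMP4 : ∀ k ω, (Psid k ω * Psi k ω)ᵀ = Psid k ω * Psi k ω

namespace SMCSetup

variable {Ω : Type} [mΩ : MeasurableSpace Ω] {μ : Measure Ω} {T n : ℕ}

/-- The path of the chain up to time `k`, extended by zero after time `k`. -/
noncomputable def hist (S : SMCSetup Ω μ T n) (k : ℕ) (ω : Ω) : ℕ → Fin n → ℝ :=
  fun j => if j ≤ k then S.Xbar j ω else 0

lemma F_eq_comap_hist (S : SMCSetup Ω μ T n) (k : ℕ) :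
    S.F k = MeasurableSpace.comap (S.hist k) inferInstance := by
  rw [S.hF]
  apply le_antisymm
  · refine iSup₂_le fun j hj => ?_
    have hj' : j ≤ k := Nat.lt_succ_iff.1 (Finset.mem_range.1 hj)
    have : S.Xbar j = (fun p : ℕ → Fin n → ℝ => p j) ∘ S.hist k := by
      funext ω; simp [hist, hj']
    rw [this, ← MeasurableSpace.comap_comp]
    exact MeasurableSpace.comap_mono (measurable_pi_apply j).comap_le
  · refine measurable_iff_comap_le.1 (@measurable_pi_iff _ _ _ (_) _ _ |>.2 fun j => ?_)
    by_cases hj : j ≤ k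
    · simp only [hist, hj, if_true]
      refine measurable_iff_comap_le.2 ?_
      exact le_iSup₂_of_le j (Finset.mem_range.2 (Nat.lt_succ_iff.2 hj)) le_rfl
    · simp only [hist, hj, if_false]
      exact @measurable_const _ _ _ (_) _

lemma finite_range_hist (S : SMCSetup Ω μ T n) (k : ℕ) : (Set.range (S.hist k)).Finite := by
  let e : (Fin (k + 1) → Fin n) → ℕ → Fin n → ℝ := fun a j =>
    if h : j ≤ k then Pi.single (a ⟨j, Nat.lt_succ_iff.2 h⟩) 1 else 0
  refine (Set.finite_range e).subset ?_
  rintro _ ⟨ω, rfl⟩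
  choose a ha using fun j => S.hXval j ω
  refine ⟨fun j => a j, ?_⟩
  funext j
  by_cases h : j ≤ k <;> simp [e, hist, h, ha]

lemma hist_succ (S : SMCSetup Ω μ T n) (k : ℕ) (ω : Ω) :
    S.hist (k + 1) ω = Function.update (S.hist k ω) (k + 1) (S.Xbar (k + 1) ω) := by
  funext j
  by_cases hj : j = k + 1
  · subst hj; simp [hist]
  · have : j ≤ k + 1 ↔ j ≤ k := by omega
    simp [hist, Function.update_of_ne hj, this]

lemma Xbar_factorsThrough_hist (S : SMCSetup Ω μ T n) (k : ℕ) :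
    (S.Xbar k).FactorsThrough (S.hist k) := fun ω ω' h => by
  simpa [hist] using congrFun h k

lemma F_le (S : SMCSetup Ω μ T n) (k : ℕ) : S.F k ≤ mΩ := by
  rw [S.hF]
  exact iSup₂_le fun j _ => (S.hXmeas j).comap_le

lemma measurable_F_iff {β : Type*} [MeasurableSpace β] [MeasurableSingletonClass β]
    (S : SMCSetup Ω μ T n) (k : ℕ) (g : Ω → β) :
    Measurable[S.F k] g ↔ g.FactorsThrough (S.hist k) := by
  rw [F_eq_comap_hist]
  constructor
  · intro hg ω ω' h
    obtain ⟨s, -, hs⟩ := hg (measurableSet_singleton (g ω'))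
    have h' : ω' ∈ S.hist k ⁻¹' s := by rw [hs]; rfl
    have : ω ∈ S.hist k ⁻¹' s := by rw [Set.mem_preimage, h]; exact h'
    rw [hs] at this
    exact this
  · intro hg B _
    refine ⟨S.hist k '' (g ⁻¹' B),
      ((S.finite_range_hist k).subset (Set.image_subset_range _ _)).measurableSet, ?_⟩
    ext ω
    constructor
    · rintro ⟨ω', h', h⟩
      change g ω ∈ B
      rw [← hg h]
      exact h'
    · exact fun h => ⟨ω, h, rfl⟩

lemma ae_of_ae_on_hist (S : SMCSetup Ω μ T n) (k : ℕ) {p : Ω → Prop}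
    (h : ∀ ω₀, ∀ᵐ ω ∂μ, S.hist k ω = S.hist k ω₀ → p ω) : ∀ᵐ ω ∂μ, p ω := by
  have := (ae_ball_iff (S.finite_range_hist k).countable
    (p := fun ω b _ => S.hist k ω = b → p ω)).2 (by
      rintro _ ⟨ω₀, rfl⟩
      exact h ω₀)
  filter_upwards [this] with ω hω
  exact hω _ ⟨ω, rfl⟩ rfl

/-- A property holding almost surely for each fixed parameter also holds almost surely along an
adapted parameter, as the latter takes finitely many values. -/
lemma ae_of_adapted_param {β : Type*} (S : SMCSetup Ω μ T n) (k : ℕ) {p : Ω → β → Prop}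
    (h : ∀ b, ∀ᵐ ω ∂μ, p ω b) {g : Ω → β} (hg : g.FactorsThrough (S.hist k)) :
    ∀ᵐ ω ∂μ, p ω (g ω) := by
  refine S.ae_of_ae_on_hist k fun ω₀ => ?_
  filter_upwards [h (g ω₀)] with ω hω hh
  rwa [hg hh]

/-- If an adapted variable plus an adapted multiple of the next martingale increment vanishes
almost surely, then so does the adapted variable. -/
lemma ae_eq_zero_of_add_dotProduct_Mbar [IsProbabilityMeasure μ] (S : SMCSetup Ω μ T n) {k : ℕ}
    (hk : k < T) {D : Ω → ℝ} {ζ : Ω → Fin n → ℝ} (hD : D.FactorsThrough (S.hist k))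
    (hζ : ζ.FactorsThrough (S.hist k))
    (h : ∀ᵐ ω ∂μ, D ω + ζ ω ⬝ᵥ S.Mbar (k + 1) ω = 0) : ∀ᵐ ω ∂μ, D ω = 0 := by
  refine S.ae_of_ae_on_hist k fun ω₀ => ?_
  by_cases hA : μ {ω | S.hist k ω = S.hist k ω₀} = 0
  · filter_upwards [measure_eq_zero_iff_ae_notMem.1 hA] with ω hω hω'
    exact absurd hω' hω
  obtain ⟨a, ha⟩ := S.hXval k ω₀
  have hXa : ∀ ω, S.hist k ω = S.hist k ω₀ → S.Xbar k ω = Pi.single a 1 := fun ω hω => by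
    rw [S.Xbar_factorsThrough_hist k hω, ha]
  have hmeas : MeasurableSet[S.F k] {ω | S.hist k ω = S.hist k ω₀} := by
    rw [F_eq_comap_hist]
    exact ⟨{S.hist k ω₀}, measurableSet_singleton _, rfl⟩
  have key : ∀ j, S.C j a * (D ω₀ + (ζ ω₀ j - ζ ω₀ ⬝ᵥ (S.C *ᵥ Pi.single a 1))) = 0 := by
    intro j
    rcases (S.hCnonneg j a).eq_or_lt with hC | hC
    · rw [← hC, zero_mul]
    have hM := S.hMarkov k hk a j _ hmeas
    rw [Set.inter_eq_left.2 (show {ω | S.hist k ω = S.hist k ω₀} ⊆ {ω | S.Xbar k ω = Pi.single a 1} from hXa)] at hM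
    have hpos : μ ({ω | S.hist k ω = S.hist k ω₀} ∩ {ω | S.Xbar (k + 1) ω = Pi.single j 1} ∩
        {ω | S.Xbar k ω = Pi.single a 1}) ≠ 0 := by
      rw [hM]
      exact mul_ne_zero (ENNReal.ofReal_pos.2 hC).ne' hA
    obtain ⟨ω, ⟨⟨hω, hωj⟩, hωa⟩, hω0⟩ :=
      ((frequently_ae_mem_iff.2 hpos).and_eventually h).exists
    rw [Set.mem_ofPred_eq] at hω hωj hωa
    rw [S.hMbar, hωj, hωa, hD hω, hζ hω, dotProduct_sub, dotProduct_single_one] at hω0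
    rw [hω0, mul_zero]
  have hsum := Finset.sum_eq_zero fun j (_ : j ∈ Finset.univ) => key j
  have hdot : ζ ω₀ ⬝ᵥ (S.C *ᵥ Pi.single a 1) = ∑ j, S.C j a * ζ ω₀ j := by
    simp [dotProduct, mul_comm]
  have hD0 : D ω₀ = 0 := by
    simp only [mul_add, mul_sub, Finset.sum_add_distrib, Finset.sum_sub_distrib,
      ← Finset.sum_mul, S.hCcol a, ← hdot] at hsum
    linarith
  exact ae_of_all _ fun ω hω => by rw [hD hω, hD0]

lemma driver_factorsThrough {β γ δ : Type*} [MeasurableSpace δ] [MeasurableSingletonClass δ]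
    (S : SMCSetup Ω μ T n) {k : ℕ} {f : Ω → β → γ → δ}
    (hf : ∀ y z, Measurable[S.F k] fun ω => f ω y z) : f.FactorsThrough (S.hist k) :=
  fun _ _ h => funext₂ fun y z => (S.measurable_F_iff k _).1 (hf y z) h

/-- One backward step of the difference equation is solvable by adapted variables. -/
lemma exists_step (S : SMCSetup Ω μ T n) {k : ℕ} {W : Ω → ℝ} (hW : Measurable[S.F (k + 1)] W)
    {f : Ω → ℝ → (Fin n → ℝ) → ℝ} (hf : ∀ y z, Measurable[S.F k] fun ω => f ω y z)
    (hsurj : ∀ z, ∀ᵐ ω ∂μ, Function.Surjective fun y : ℝ => y - f ω y z) :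
    ∃ (y : Ω → ℝ) (z : Ω → Fin n → ℝ), Measurable[S.F k] y ∧ Measurable[S.F k] z ∧
      ∀ᵐ ω ∂μ, y ω = W ω + f ω (y ω) (z ω) - z ω ⬝ᵥ S.Mbar (k + 1) ω := by
  obtain ⟨φ, hφ⟩ := (Function.factorsThrough_iff W).1 ((S.measurable_F_iff _ _).1 hW)
  let z : Ω → Fin n → ℝ := fun ω j => φ (Function.update (S.hist k ω) (k + 1) (Pi.single j 1))
  have hz : z.FactorsThrough (S.hist k) := fun ω ω' h => by simp only [z, h]
  let y : Ω → ℝ := fun ω =>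
    Function.invFun (fun y => y - f ω y (z ω)) (z ω ⬝ᵥ (S.C *ᵥ S.Xbar k ω))
  have hy : y.FactorsThrough (S.hist k) := fun ω ω' h => by
    simp only [y, hz h, S.Xbar_factorsThrough_hist k h, S.driver_factorsThrough hf h]
  refine ⟨y, z, (S.measurable_F_iff _ _).2 hy, (S.measurable_F_iff _ _).2 hz, ?_⟩
  filter_upwards [S.ae_of_adapted_param k hsurj hz] with ω hω
  have h1 : y ω - f ω (y ω) (z ω) = z ω ⬝ᵥ (S.C *ᵥ S.Xbar k ω) :=
    Function.invFun_eq (hω (z ω ⬝ᵥ (S.C *ᵥ S.Xbar k ω)))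
  have h2 : W ω = z ω ⬝ᵥ S.Xbar (k + 1) ω := by
    obtain ⟨j, hj⟩ := S.hXval (k + 1) ω
    rw [hφ, Function.comp_apply, hist_succ, hj]
    simp [z]
  rw [S.hMbar, dotProduct_sub, ← h2]
  linarith

/-- Adapted solutions of one backward step are unique up to the martingale-increment equivalence. -/
lemma step_unique [IsProbabilityMeasure μ] (S : SMCSetup Ω μ T n) {k : ℕ} (hk : k < T)
    {W W' : Ω → ℝ} (hWW' : W =ᵐ[μ] W')
    {f : Ω → ℝ → (Fin n → ℝ) → ℝ} (hf : ∀ y z, Measurable[S.F k] fun ω => f ω y z)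
    (hequiv : ∀ (y : Ω → ℝ) (z z' : Ω → Fin n → ℝ),
      Measurable[S.F k] y → Measurable[S.F k] z → Measurable[S.F k] z' →
      ((fun ω => z ω ⬝ᵥ S.Mbar (k + 1) ω) =ᵐ[μ] fun ω => z' ω ⬝ᵥ S.Mbar (k + 1) ω) →
      ((fun ω => f ω (y ω) (z ω)) =ᵐ[μ] fun ω => f ω (y ω) (z' ω)))
    (hinj : ∀ z, ∀ᵐ ω ∂μ, Function.Injective fun y : ℝ => y - f ω y z)
    {y y' : Ω → ℝ} {z z' : Ω → Fin n → ℝ}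
    (hy : Measurable[S.F k] y) (hy' : Measurable[S.F k] y')
    (hz : Measurable[S.F k] z) (hz' : Measurable[S.F k] z')
    (h : ∀ᵐ ω ∂μ, y ω = W ω + f ω (y ω) (z ω) - z ω ⬝ᵥ S.Mbar (k + 1) ω)
    (h' : ∀ᵐ ω ∂μ, y' ω = W' ω + f ω (y' ω) (z' ω) - z' ω ⬝ᵥ S.Mbar (k + 1) ω) :
    y =ᵐ[μ] y' ∧
      (fun ω => z ω ⬝ᵥ S.Mbar (k + 1) ω) =ᵐ[μ] fun ω => z' ω ⬝ᵥ S.Mbar (k + 1) ω := by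
  have hyF := (S.measurable_F_iff _ _).1 hy
  have hyF' := (S.measurable_F_iff _ _).1 hy'
  have hzF := (S.measurable_F_iff _ _).1 hz
  have hzF' := (S.measurable_F_iff _ _).1 hz'
  have hfF := S.driver_factorsThrough hf
  have hD : ∀ᵐ ω ∂μ, (y ω - f ω (y ω) (z ω)) - (y' ω - f ω (y' ω) (z' ω)) = 0 := by
    refine S.ae_eq_zero_of_add_dotProduct_Mbar hk (ζ := fun ω => z ω - z' ω) ?_ ?_ ?_
    · intro ω ω' e
      simp only [hyF e, hyF' e, hzF e, hzF' e, hfF e]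
    · intro ω ω' e
      simp only [hzF e, hzF' e]
    · filter_upwards [h, h', hWW'] with ω h1 h2 h3
      rw [sub_dotProduct]
      linarith
  have hZ : (fun ω => z ω ⬝ᵥ S.Mbar (k + 1) ω) =ᵐ[μ] fun ω => z' ω ⬝ᵥ S.Mbar (k + 1) ω := by
    filter_upwards [h, h', hWW', hD] with ω h1 h2 h3 h4
    linarith
  refine ⟨?_, hZ⟩
  filter_upwards [hD, hequiv y' z z' hy' hz hz' hZ, S.ae_of_adapted_param k hinj hzF]
    with ω h1 h2 h3
  apply h3
  dsimp only at h2 ⊢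
  linarith

end SMCSetup

/-- Almost sure equivalence of the summed backward equation and its one-step form. -/
lemma ae_backward_sum_iff {Ω : Type*} [MeasurableSpace Ω] {μ : Measure Ω} {T : ℕ}
    {Q : Ω → ℝ} {Y a b : ℕ → Ω → ℝ} (hT : ∀ᵐ ω ∂μ, Y T ω = Q ω) :
    (∀ i, i < T → ∀ᵐ ω ∂μ, Y i ω = Q ω + (∑ u ∈ Finset.Ico i T, a u ω)
        - ∑ u ∈ Finset.Ico i T, b u ω) ↔
      ∀ i, i < T → ∀ᵐ ω ∂μ, Y i ω = Y (i + 1) ω + a i ω - b i ω := by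
  constructor
  · intro h i hi
    have hnext : ∀ᵐ ω ∂μ, Y (i + 1) ω = Q ω + (∑ u ∈ Finset.Ico (i + 1) T, a u ω)
        - ∑ u ∈ Finset.Ico (i + 1) T, b u ω := by
      rcases (Nat.succ_le_of_lt hi).lt_or_eq with h1 | h1
      · exact h _ h1
      · rw [show i + 1 = T from h1]
        simpa using hT
    filter_upwards [h i hi, hnext] with ω h1 h2
    rw [Finset.sum_eq_sum_Ico_succ_bot hi, Finset.sum_eq_sum_Ico_succ_bot hi] at h1
    linarith
  · intro h i hi
    refine Nat.decreasingInduction (motive := fun i _ => ∀ᵐ ω ∂μ,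
      Y i ω = Q ω + (∑ u ∈ Finset.Ico i T, a u ω) - ∑ u ∈ Finset.Ico i T, b u ω)
      (fun k hk ih => ?_) (by simpa using hT) hi.le
    filter_upwards [h k hk, ih] with ω h1 h2
    rw [Finset.sum_eq_sum_Ico_succ_bot hk, Finset.sum_eq_sum_Ico_succ_bot hk]
    linarith

/-- Existence and uniqueness (up to indistinguishability for `Y` and
up to the equivalence `Z_i M̄_{i+1} = Z_i' M̄_{i+1}` a.s. for `Z`) of an adapted
solution of the BSDE with driver `f`. -/
theorem statement8
    {Ω : Type} [mΩ : MeasurableSpace Ω] (μ : Measure Ω) [IsProbabilityMeasure μ]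
    (T n : ℕ) (S : SMCSetup Ω μ T n)
    (Q : Ω → ℝ) (hQmeas : Measurable[S.F T] Q)
    (hQbdd : ∃ c : ℝ, ∀ᵐ ω ∂μ, |Q ω| ≤ c)
    (f : Ω → ℕ → ℝ → (Fin n → ℝ) → ℝ)
    (hfadapted : ∀ i, i < T → ∀ (y : ℝ) (z : Fin n → ℝ),
      Measurable[S.F i] (fun ω => f ω i y z))
    (hfmeas : ∀ i, i < T →
      Measurable (fun pr : Ω × ℝ × (Fin n → ℝ) => f pr.1 i pr.2.1 pr.2.2))
    -- (i): invariance under the equivalence `∼_{M̄_{i+1}}`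
    (hfequiv : ∀ i, i < T → ∀ (Yi : Ω → ℝ) (Za Zb : Ω → (Fin n → ℝ)),
      Measurable[S.F i] Yi → Measurable[S.F i] Za → Measurable[S.F i] Zb →
      ((fun ω => Za ω ⬝ᵥ S.Mbar (i + 1) ω) =ᵐ[μ] fun ω => Zb ω ⬝ᵥ S.Mbar (i + 1) ω) →
      ((fun ω => f ω i (Yi ω) (Za ω)) =ᵐ[μ] fun ω => f ω i (Yi ω) (Zb ω)))
    -- (ii): `y ↦ y − f(i, y, z)` is a.s. a bijection of `ℝ`
    (hfbij : ∀ i, i < T → ∀ z : Fin n → ℝ, ∀ᵐ ω ∂μ,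
      Function.Bijective fun y : ℝ => y - f ω i y z) :
    ∃ Y : ℕ → Ω → ℝ, ∃ Z : ℕ → Ω → (Fin n → ℝ),
      (∀ i, i ≤ T → Measurable[S.F i] (Y i)) ∧
      (∀ i, i < T → Measurable[S.F i] (Z i)) ∧
      (∀ᵐ ω ∂μ, Y T ω = Q ω) ∧
      (∀ i, i < T → ∀ᵐ ω ∂μ,
        Y i ω = Q ω + (∑ u ∈ Finset.Ico i T, f ω u (Y u ω) (Z u ω))
          - ∑ u ∈ Finset.Ico i T, Z u ω ⬝ᵥ S.Mbar (u + 1) ω) ∧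
      -- uniqueness
      (∀ Y' : ℕ → Ω → ℝ, ∀ Z' : ℕ → Ω → (Fin n → ℝ),
        (∀ i, i ≤ T → Measurable[S.F i] (Y' i)) →
        (∀ i, i < T → Measurable[S.F i] (Z' i)) →
        (∀ᵐ ω ∂μ, Y' T ω = Q ω) →
        (∀ i, i < T → ∀ᵐ ω ∂μ,
          Y' i ω = Q ω + (∑ u ∈ Finset.Ico i T, f ω u (Y' u ω) (Z' u ω))
            - ∑ u ∈ Finset.Ico i T, Z' u ω ⬝ᵥ S.Mbar (u + 1) ω) →
        (∀ i, i ≤ T → Y i =ᵐ[μ] Y' i) ∧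
        (∀ i, i < T →
          (fun ω => Z i ω ⬝ᵥ S.Mbar (i + 1) ω)
            =ᵐ[μ] fun ω => Z' i ω ⬝ᵥ S.Mbar (i + 1) ω)) := by
  have exist : ∃ (Y : ℕ → Ω → ℝ) (Z : ℕ → Ω → Fin n → ℝ), Y T = Q ∧
      (∀ i, 0 ≤ i → i ≤ T → Measurable[S.F i] (Y i)) ∧
      (∀ i, 0 ≤ i → i < T → Measurable[S.F i] (Z i) ∧ ∀ᵐ ω ∂μ,
        Y i ω = Y (i + 1) ω + f ω i (Y i ω) (Z i ω) - Z i ω ⬝ᵥ S.Mbar (i + 1) ω) := by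
    refine Nat.decreasingInduction (motive := fun k _ =>
      ∃ (Y : ℕ → Ω → ℝ) (Z : ℕ → Ω → Fin n → ℝ), Y T = Q ∧
        (∀ i, k ≤ i → i ≤ T → Measurable[S.F i] (Y i)) ∧
        (∀ i, k ≤ i → i < T → Measurable[S.F i] (Z i) ∧ ∀ᵐ ω ∂μ,
          Y i ω = Y (i + 1) ω + f ω i (Y i ω) (Z i ω) - Z i ω ⬝ᵥ S.Mbar (i + 1) ω))
      ?_ ?_ (Nat.zero_le T)
    · rintro k hk ⟨Y, Z, hYT, hY, hZ⟩
      obtain ⟨y, z, hy, hz, hyz⟩ := S.exists_step (hY (k + 1) le_rfl hk)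
        (hfadapted k hk) fun z => (hfbij k hk z).mono fun _ h => h.surjective
      refine ⟨Function.update Y k y, Function.update Z k z, ?_, fun i hki hi => ?_,
        fun i hki hi => ?_⟩
      · rw [Function.update_of_ne hk.ne', hYT]
      · rcases hki.eq_or_lt with rfl | hlt
        · simpa using hy
        · rw [Function.update_of_ne hlt.ne']
          exact hY i hlt hi
      · rw [Function.update_of_ne (a := i + 1) (by omega)]
        rcases hki.eq_or_lt with rfl | hlt
        · simpa using ⟨hz, hyz⟩
        · rw [Function.update_of_ne hlt.ne', Function.update_of_ne hlt.ne']
          exact hZ i hlt hi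
    · refine ⟨fun _ => Q, fun _ _ => 0, rfl, fun i hi hi' => ?_, fun i hi hi' => by omega⟩
      rwa [le_antisymm hi' hi]
  obtain ⟨Y, Z, hYT, hY, hZ⟩ := exist
  have hYT' : ∀ᵐ ω ∂μ, Y T ω = Q ω := ae_of_all _ fun ω => by rw [hYT]
  refine ⟨Y, Z, fun i => hY i i.zero_le, fun i hi => (hZ i i.zero_le hi).1, hYT',
    (ae_backward_sum_iff hYT').2 fun i hi => (hZ i i.zero_le hi).2, ?_⟩
  intro Y' Z' hY' hZ' hY'T hsum
  have hstep := (ae_backward_sum_iff hY'T).1 hsum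
  have next (i : ℕ) (hi : i < T) (h : Y (i + 1) =ᵐ[μ] Y' (i + 1)) :=
    S.step_unique hi h (hfadapted i hi) (hfequiv i hi)
      (fun z => (hfbij i hi z).mono fun _ h => h.injective)
      (hY i i.zero_le hi.le) (hY' i hi.le) (hZ i i.zero_le hi).1 (hZ' i hi)
      (hZ i i.zero_le hi).2 (hstep i hi)
  have hYY' : ∀ i, i ≤ T → Y i =ᵐ[μ] Y' i := fun i hi =>
    Nat.decreasingInduction (motive := fun i _ => Y i =ᵐ[μ] Y' i)
      (fun k hk ih => (next k hk ih).1)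
      (by filter_upwards [hYT', hY'T] with ω h1 h2; rw [h1, h2]) hi
  exact ⟨hYY', fun i hi => (next i hi (hYY' (i + 1) hi)).2⟩
end

section
/- Suppose √2·l·‖Ψ_i‖·‖Ψ_i†‖² ≤ 1 a.s. for all i, that λ > 0 is a constant with |Ψ_i†Ψ_iB| ≤ λ(B'Ψ_iB)^{1/2} for all B ∈ ℝ^n and all i, and that 6 l² λ² (Tr(C'C))^{1/2} Tr((Ψ_i†)'Ψ_i†) < 1 a.s. for all i. Then: (1) the BSDE Y_i = ξ + Σ_{k=i}^{T−1} f(k, Y_k, Z_k) − Σ_{k=i}^{T−1} Z_k M̄_{k+1}, Y_T = ξ, with maximized driver f(k, y, z) := sup_{v∈U} [α(k, v)y + β(k, v)Ψ_k†Ψ_k z' + g(k, v)], has a unique adapted solution (Y, Z) (Y unique up to indistinguishability and Z_k unique up to Z_k M̄_{k+1} a.s.); (2) for every feasible control u, Y_i^u ≤ Y_i P-a.s. for each i; and (3) there exists a sequence of feasible controls (u^{(m)})_{m∈ℕ} such that Y_i^{u^{(m)}} → Y_i in L²(P) for each i, so that Y_i is the essential supremum of {Y_i^u : u feasible}. -/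
open MeasureTheory Matrix
open scoped ENNReal

section Deterministic

open scoped Matrix.Norms.Frobenius

/-- The Frobenius norm in terms of the trace. -/
lemma sqrt_trace_transpose_mul_self {m n : Type*} [Fintype m] [Fintype n]
    (A : Matrix m n ℝ) : Real.sqrt ((Aᵀ * A).trace) = ‖A‖ := by
  rw [Matrix.frobenius_norm_def, ← Real.sqrt_eq_rpow]
  congr 1
  rw [Finset.sum_comm]
  simp [Matrix.trace, Matrix.mul_apply, pow_two]

lemma abs_dotProduct_mulVec_le {m n : Type*} [Fintype m] [Fintype n]
    (b : m → ℝ) (A : Matrix m n ℝ) (v : n → ℝ) :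
    |b ⬝ᵥ (A *ᵥ v)| ≤ Real.sqrt (b ⬝ᵥ b) * ‖A‖ * Real.sqrt (v ⬝ᵥ v) := by
  have hb : Real.sqrt (b ⬝ᵥ b) = ‖replicateRow Unit b‖ := by
    rw [← sqrt_trace_transpose_mul_self, Matrix.trace_mul_comm]
    simp [Matrix.trace, Matrix.mul_apply, dotProduct]
  have hv : Real.sqrt (v ⬝ᵥ v) = ‖replicateCol Unit v‖ := by
    rw [← sqrt_trace_transpose_mul_self]
    simp [Matrix.trace, Matrix.mul_apply, dotProduct]
  have h : |b ⬝ᵥ (A *ᵥ v)| = ‖replicateRow Unit b * A * replicateCol Unit v‖ := by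
    rw [← sqrt_trace_transpose_mul_self, Matrix.mul_assoc, ← Matrix.replicateCol_mulVec]
    simp [Matrix.trace, Matrix.mul_apply, dotProduct, mul_comm, Real.sqrt_mul_self_eq_abs]
  rw [h, hb, hv]
  exact (frobenius_norm_mul _ _).trans
    (mul_le_mul_of_nonneg_right (frobenius_norm_mul _ _) (norm_nonneg _))

/-- `A * B` does not depend on the choice of `A` among the generalized inverses of `B` for which
it is symmetric. -/
lemma mul_eq_mul_of_generalizedInverse {m : Type*} [Fintype m] {A₁ A₂ B : Matrix m m ℝ}
    (h₁ : B * A₁ * B = B) (h₂ : B * A₂ * B = B)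
    (s₁ : (A₁ * B)ᵀ = A₁ * B) (s₂ : (A₂ * B)ᵀ = A₂ * B) : A₁ * B = A₂ * B := by
  have e₁ : A₁ * B * (A₂ * B) = A₁ * B := by
    rw [Matrix.mul_assoc, ← Matrix.mul_assoc B, h₂]
  have e₂ : A₂ * B * (A₁ * B) = A₂ * B := by
    rw [Matrix.mul_assoc, ← Matrix.mul_assoc B, h₁]
  calc A₁ * B = (A₁ * B * (A₂ * B))ᵀ := by rw [e₁, s₁]
    _ = A₂ * B := by rw [Matrix.transpose_mul, s₁, s₂, e₂]

variable {n : ℕ}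

lemma covariance_mulVec_single (c : Fin n → ℝ) (j : Fin n) :
    (diagonal c - vecMulVec c c) *ᵥ Pi.single j 1 = c j • (Pi.single j 1 - c) := by
  ext i
  by_cases h : i = j
  · subst h; simp [vecMulVec_apply]; ring
  · simp [vecMulVec_apply, h]; ring

/-- The smallness condition on the covariance `diag c - c c'` of a one-step transition bounds
the sensitivity of the driver in each direction by the transition probability. -/
lemma abs_dotProduct_proj_single_le (c : Fin n → ℝ) (hc : ∀ j, 0 ≤ c j) (hc1 : ∑ j, c j = 1)
    (A : Matrix (Fin n) (Fin n) ℝ)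
    (hA : (diagonal c - vecMulVec c c) * A * (diagonal c - vecMulVec c c)
      = diagonal c - vecMulVec c c)
    {l : ℝ} (hl : 0 < l)
    (hsmall : Real.sqrt 2 * l * ‖diagonal c - vecMulVec c c‖ * ‖A‖ ^ 2 ≤ 1)
    (b : Fin n → ℝ) (hb : Real.sqrt (b ⬝ᵥ b) ≤ l) (j : Fin n) :
    |b ⬝ᵥ ((A * (diagonal c - vecMulVec c c)) *ᵥ Pi.single j 1)| ≤ c j := by
  set Q := diagonal c - vecMulVec c c with hQ
  by_cases hQ0 : Q = 0
  · rw [hQ0, Matrix.mul_zero, zero_mulVec, dotProduct_zero, abs_zero]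
    exact hc j
  have hpos : 0 < ‖Q‖ := norm_pos_iff.2 hQ0
  have h1 : 1 ≤ ‖Q‖ * ‖A‖ := by
    have : ‖Q‖ ≤ ‖Q‖ * ‖A‖ * ‖Q‖ := by
      calc ‖Q‖ = ‖Q * A * Q‖ := by rw [hA]
        _ ≤ ‖Q * A‖ * ‖Q‖ := frobenius_norm_mul _ _
        _ ≤ _ := mul_le_mul_of_nonneg_right (frobenius_norm_mul _ _) (norm_nonneg _)
    exact le_of_mul_le_mul_right (by simpa using this) hpos
  have hbound : Real.sqrt 2 * l * ‖A‖ ≤ 1 := by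
    refine le_trans ?_ hsmall
    calc Real.sqrt 2 * l * ‖A‖ = Real.sqrt 2 * l * ‖A‖ * 1 := by ring
      _ ≤ Real.sqrt 2 * l * ‖A‖ * (‖Q‖ * ‖A‖) := by gcongr
      _ = _ := by ring
  have hcle : ∀ i, c i ≤ 1 := fun i =>
    hc1 ▸ Finset.single_le_sum (fun i _ => hc i) (Finset.mem_univ i)
  have hw : (Pi.single j 1 - c) ⬝ᵥ (Pi.single j 1 - c) ≤ 2 := by
    have hcc : c ⬝ᵥ c ≤ 1 := by
      rw [← hc1]
      exact Finset.sum_le_sum fun i _ => mul_le_of_le_one_left (hc i) (hcle i)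
    simp only [sub_dotProduct, dotProduct_sub, single_dotProduct, dotProduct_single,
      Pi.sub_apply, Pi.single_eq_same]
    linarith [hc j]
  have hcol : Real.sqrt ((Q *ᵥ Pi.single j 1) ⬝ᵥ (Q *ᵥ Pi.single j 1)) ≤ Real.sqrt 2 * c j := by
    rw [hQ, covariance_mulVec_single, smul_dotProduct, dotProduct_smul, smul_eq_mul, smul_eq_mul]
    refine Real.sqrt_le_iff.2 ⟨mul_nonneg (Real.sqrt_nonneg _) (hc j), ?_⟩
    rw [mul_pow, Real.sq_sqrt zero_le_two]
    nlinarith [mul_le_mul_of_nonneg_left hw (sq_nonneg (c j))]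
  rw [← Matrix.mulVec_mulVec]
  calc _ ≤ Real.sqrt (b ⬝ᵥ b) * ‖A‖ * Real.sqrt ((Q *ᵥ Pi.single j 1) ⬝ᵥ (Q *ᵥ Pi.single j 1)) :=
        abs_dotProduct_mulVec_le _ _ _
    _ ≤ l * ‖A‖ * (Real.sqrt 2 * c j) := by gcongr
    _ = Real.sqrt 2 * l * ‖A‖ * c j := by ring
    _ ≤ 1 * c j := mul_le_mul_of_nonneg_right hbound (hc j)
    _ = c j := one_mul _

/-- Comparison over one step of the chain, with transition probabilities `c`. -/
lemma nonneg_of_onestep (c : Fin n → ℝ) (hc : ∀ j, 0 ≤ c j) (hc1 : ∑ j, c j = 1)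
    (A : Matrix (Fin n) (Fin n) ℝ)
    (hA : (diagonal c - vecMulVec c c) * A * (diagonal c - vecMulVec c c)
      = diagonal c - vecMulVec c c)
    {l : ℝ} (hl : 0 < l)
    (hsmall : Real.sqrt 2 * l * ‖diagonal c - vecMulVec c c‖ * ‖A‖ ^ 2 ≤ 1)
    (b : Fin n → ℝ) (hb : Real.sqrt (b ⬝ᵥ b) ≤ l) {a : ℝ} (ha : a < 1)
    {y D : ℝ} {h z : Fin n → ℝ}
    (hstep : ∀ j, 0 < c j → y = h j + D - (z j - c ⬝ᵥ z)) (hh : ∀ j, 0 < c j → 0 ≤ h j)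
    (hD : a * y + b ⬝ᵥ ((A * (diagonal c - vecMulVec c c)) *ᵥ z) ≤ D) : 0 ≤ y := by
  have hγ := abs_dotProduct_proj_single_le c hc hc1 A hA hl hsmall b hb
  set Q := diagonal c - vecMulVec c c with hQ
  set γ : Fin n → ℝ := fun j => b ⬝ᵥ ((A * Q) *ᵥ Pi.single j 1) with hγdef
  have hγ' : ∀ j, γ j = (b ᵥ* (A * Q)) j := fun j => by
    simp only [hγdef, dotProduct_mulVec, dotProduct_single, mul_one]
  have hlin : ∀ w : Fin n → ℝ, b ⬝ᵥ ((A * Q) *ᵥ w) = ∑ j, γ j * w j := fun w => by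
    rw [dotProduct_mulVec]
    exact Finset.sum_congr rfl fun j _ => by rw [hγ']
  have hγ0 : ∀ j, c j = 0 → γ j = 0 := fun j hj => abs_nonpos_iff.1 (hj ▸ hγ j)
  have hQ1 : Q *ᵥ 1 = 0 := by
    ext i
    simp [hQ, sub_mulVec, mulVec_diagonal, vecMulVec_mulVec, dotProduct_one, hc1]
  have hγsum : ∑ j, γ j = 0 := by
    have := hlin 1
    rw [← mulVec_mulVec, hQ1] at this
    simpa using this.symm
  have hmean : y = (∑ j, c j * h j) + D := by
    have e : ∀ j, c j * y = c j * h j + c j * D - (c j * z j - c j * (c ⬝ᵥ z)) := fun j => by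
      rcases (hc j).eq_or_lt with h0 | h0
      · simp [← h0]
      · rw [hstep j h0]; ring
    have := Finset.sum_congr rfl fun j (_ : j ∈ Finset.univ) => e j
    simp only [Finset.sum_sub_distrib, Finset.sum_add_distrib, ← Finset.sum_mul, hc1] at this
    have hz : c ⬝ᵥ z = ∑ j, c j * z j := rfl
    linarith
  have hz : b ⬝ᵥ ((A * Q) *ᵥ z) = ∑ j, γ j * h j := by
    have e : ∀ j, γ j * z j = γ j * h j + γ j * (D + c ⬝ᵥ z - y) := fun j => by
      rcases (hc j).eq_or_lt with h0 | h0
      · simp [hγ0 j h0.symm]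
      · have : z j = h j + (D + c ⬝ᵥ z - y) := by linarith [hstep j h0]
        rw [this]; ring
    rw [hlin, Finset.sum_congr rfl fun j _ => e j, Finset.sum_add_distrib, ← Finset.sum_mul,
      hγsum, zero_mul, add_zero]
  have hsum : 0 ≤ (∑ j, c j * h j) + ∑ j, γ j * h j := by
    rw [← Finset.sum_add_distrib]
    refine Finset.sum_nonneg fun j _ => ?_
    rcases (hc j).eq_or_lt with h0 | h0
    · simp [hγ0 j h0.symm, ← h0]
    · rw [← add_mul]
      exact mul_nonneg (by linarith [(abs_le.1 (hγ j)).1]) (hh j h0)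
  have : 0 ≤ (1 - a) * y := by linarith
  exact nonneg_of_mul_nonneg_right this (by linarith)

end Deterministic

namespace SMCSetup

variable {Ω : Type} [mΩ : MeasurableSpace Ω] {μ : Measure Ω} {T n : ℕ} (S : SMCSetup Ω μ T n)

/-- Two outcomes whose paths agree up to time `k`. -/
def SamePath (k : ℕ) (ω ω' : Ω) : Prop := ∀ j ≤ k, S.Xbar j ω = S.Xbar j ω'

/-- A function depending only on the path up to time `k`. -/
def PathDependent {E : Type*} (k : ℕ) (φ : Ω → E) : Prop :=
  ∀ ⦃ω ω'⦄, S.SamePath k ω ω' → φ ω = φ ω'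

lemma le_ambient (k : ℕ) : S.F k ≤ mΩ := by
  rw [S.hF]
  exact iSup₂_le fun j _ => (S.hXmeas j).comap_le

lemma measurable_Xbar {j k : ℕ} (h : j ≤ k) : Measurable[S.F k] (S.Xbar j) := by
  rw [S.hF]
  exact Measurable.mono (comap_measurable _)
    (le_iSup₂_of_le j (Finset.mem_range.2 (Nat.lt_succ_of_le h)) le_rfl) le_rfl

lemma mem_iff_of_samePath {k : ℕ} {A : Set Ω} (hA : MeasurableSet[S.F k] A) {ω ω' : Ω}
    (h : S.SamePath k ω ω') : ω ∈ A ↔ ω' ∈ A := by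
  have hle : S.F k ≤
      { MeasurableSet' := fun A => ω ∈ A ↔ ω' ∈ A
        measurableSet_empty := by simp
        measurableSet_compl := fun A hA => not_congr hA
        measurableSet_iUnion := fun A hA => by simp [hA] } := by
    rw [S.hF]
    refine iSup₂_le fun j hj => ?_
    rintro _ ⟨B, -, rfl⟩
    change S.Xbar j ω ∈ B ↔ S.Xbar j ω' ∈ B
    rw [h j (Nat.lt_succ_iff.1 (Finset.mem_range.1 hj))]
  exact hle A hA

lemma PathDependent.of_measurable {E : Type*} [MeasurableSpace E] [MeasurableSingletonClass E]
    {k : ℕ} {φ : Ω → E} (h : Measurable[S.F k] φ) : S.PathDependent k φ := fun _ ω' hω =>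
  ((S.mem_iff_of_samePath (h (measurableSet_singleton (φ ω'))) hω).2 rfl)

/-- The state of the chain, as an index. -/
noncomputable def state (k : ℕ) (ω : Ω) : Fin n := (S.hXval k ω).choose

lemma Xbar_eq (k : ℕ) (ω : Ω) : S.Xbar k ω = Pi.single (S.state k ω) 1 :=
  (S.hXval k ω).choose_spec

lemma Xbar_eq_single_iff (k : ℕ) (ω : Ω) (i : Fin n) :
    S.Xbar k ω = Pi.single i 1 ↔ S.state k ω = i := by
  rw [Xbar_eq]
  refine ⟨fun h => ?_, fun h => by rw [h]⟩
  by_contra hne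
  simpa [hne] using congrFun h (S.state k ω)

lemma measurable_state {j k : ℕ} (h : j ≤ k) : Measurable[S.F k] (S.state j) := by
  refine @measurable_to_countable' _ _ _ _ (S.F k) _ fun i => ?_
  have : S.state j ⁻¹' {i} = S.Xbar j ⁻¹' {Pi.single i 1} := by
    ext ω; simp [Xbar_eq_single_iff]
  rw [this]
  exact S.measurable_Xbar h (measurableSet_singleton _)

lemma PathDependent.measurable {E : Type*} [MeasurableSpace E] {k : ℕ} {φ : Ω → E}
    (h : S.PathDependent k φ) : Measurable[S.F k] φ := by
  rcases isEmpty_or_nonempty Ω with hΩ | ⟨⟨ω₀⟩⟩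
  · exact @measurable_of_empty _ _ (S.F k) _ _ φ
  have hlabel : Measurable[S.F k] fun ω (j : Fin (k + 1)) => S.state j ω := 
    @measurable_pi_lambda _ _ _ (S.F k) _ _ fun j => S.measurable_state (Nat.lt_succ_iff.1 j.2)
  have hfac : φ.FactorsThrough fun ω (j : Fin (k + 1)) => S.state j ω := fun ω ω' hω =>
    h fun j hj => by
      rw [Xbar_eq, Xbar_eq]
      exact congrArg (fun i => Pi.single i (1 : ℝ))
        (congrFun hω ⟨j, Nat.lt_succ_of_le hj⟩)
  rw [← hfac.extend_comp (fun _ => φ ω₀)]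
  exact (measurable_of_countable _).comp hlabel

lemma mulVec_Xbar_apply (k : ℕ) (ω : Ω) (j : Fin n) :
    (S.C *ᵥ S.Xbar k ω) j = S.C j (S.state k ω) := by
  rw [Xbar_eq]; simp

lemma mulVec_Xbar_nonneg (k : ℕ) (ω : Ω) (j : Fin n) : 0 ≤ (S.C *ᵥ S.Xbar k ω) j := by
  rw [mulVec_Xbar_apply]; exact S.hCnonneg _ _

lemma sum_mulVec_Xbar (k : ℕ) (ω : Ω) : ∑ j, (S.C *ᵥ S.Xbar k ω) j = 1 := by
  simp_rw [mulVec_Xbar_apply]; exact S.hCcol _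

lemma SamePath.Xbar_eq {k : ℕ} {ω ω' : Ω} (h : S.SamePath k ω ω') :
    S.Xbar k ω = S.Xbar k ω' := h k le_rfl

lemma SamePath.symm {k : ℕ} {ω ω' : Ω} (h : S.SamePath k ω ω') : S.SamePath k ω' ω :=
  fun j hj => (h j hj).symm

lemma SamePath.trans {k : ℕ} {ω ω' ω'' : Ω} (h : S.SamePath k ω ω')
    (h' : S.SamePath k ω' ω'') : S.SamePath k ω ω'' := fun j hj => (h j hj).trans (h' j hj)

lemma dotProduct_Mbar (k : ℕ) (ω : Ω) (z : Fin n → ℝ) :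
    z ⬝ᵥ S.Mbar (k + 1) ω = z (S.state (k + 1) ω) - (S.C *ᵥ S.Xbar k ω) ⬝ᵥ z := by
  rw [S.hMbar, dotProduct_sub, S.Xbar_eq (k + 1), dotProduct_single, mul_one,
    dotProduct_comm z (S.C *ᵥ _)]

/-- A property of the next state, decided by the past, holds at every state that can be
reached, as soon as it almost surely holds at the state that is reached. -/
lemma ae_forall_of_ae_next {k : ℕ} (hk : k < T) {p : Ω → Fin n → Prop}
    (hp : ∀ j, S.PathDependent k fun ω => p ω j)
    (h : ∀ᵐ ω ∂μ, p ω (S.state (k + 1) ω)) :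
    ∀ᵐ ω ∂μ, ∀ j, 0 < (S.C *ᵥ S.Xbar k ω) j → p ω j := by
  rw [ae_all_iff]
  intro j
  have hi : ∀ i, 0 < S.C j i → ∀ᵐ ω ∂μ, S.state k ω = i → p ω j := by
    intro i hji
    have hA : MeasurableSet[S.F k] {ω | ¬ p ω j} :=
      @Measurable.setOf _ (S.F k) _ (PathDependent.measurable S fun ω ω' hω =>
        congrArg Not (hp j hω))
    have hM := S.hMarkov k hk i j _ hA
    have h0 : μ ({ω | ¬ p ω j} ∩ {ω | S.Xbar (k + 1) ω = Pi.single j 1}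
        ∩ {ω | S.Xbar k ω = Pi.single i 1}) = 0 := by
      refine measure_mono_null ?_ (ae_iff.1 h)
      rintro ω ⟨⟨h1, h2⟩, -⟩
      have h2' := (S.Xbar_eq_single_iff _ _ _).1 h2
      simpa [h2'] using h1
    rw [h0, eq_comm, mul_eq_zero] at hM
    have hM' := hM.resolve_left (by simpa using hji)
    rw [ae_iff]
    refine measure_mono_null ?_ hM'
    intro ω hω
    simp only [Set.mem_ofPred_eq, Classical.not_imp] at hω
    exact ⟨hω.2, (S.Xbar_eq_single_iff _ _ _).2 hω.1⟩
  have hall : ∀ᵐ ω ∂μ, ∀ i, 0 < S.C j i → S.state k ω = i → p ω j := by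
    rw [ae_all_iff]
    intro i
    by_cases hji : 0 < S.C j i
    · filter_upwards [hi i hji] with ω hω _ using hω
    · exact Filter.Eventually.of_forall fun ω h => absurd h hji
  filter_upwards [hall] with ω hω hpos
  exact hω _ (by rwa [mulVec_Xbar_apply] at hpos) rfl

/-- A path-dependent martingale increment that is known one step ahead vanishes. -/
lemma ae_eq_zero_of_eq_dotProduct_Mbar {k : ℕ} (hk : k < T) {a : Ω → ℝ} {z : Ω → Fin n → ℝ}
    (ha : S.PathDependent k a) (hz : S.PathDependent k z)
    (h : ∀ᵐ ω ∂μ, a ω = z ω ⬝ᵥ S.Mbar (k + 1) ω) : ∀ᵐ ω ∂μ, a ω = 0 := by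
  have := S.ae_forall_of_ae_next hk
    (p := fun ω j => a ω = z ω j - (S.C *ᵥ S.Xbar k ω) ⬝ᵥ z ω)
    (fun j ω ω' hω => by simp only [ha hω, hz hω, hω.Xbar_eq])
    (by filter_upwards [h] with ω hω; rw [hω, dotProduct_Mbar])
  filter_upwards [this] with ω hω
  set c := S.C *ᵥ S.Xbar k ω with hcdef
  have e : ∀ j, c j * a ω = c j * z ω j - c j * (c ⬝ᵥ z ω) := fun j => by
    rcases (S.mulVec_Xbar_nonneg k ω j).eq_or_lt with h0 | h0
    · rw [← hcdef] at h0
      simp [← h0]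
    · rw [hω j h0]; ring
  have hs := Finset.sum_congr rfl fun j (_ : j ∈ Finset.univ) => e j
  rw [Finset.sum_sub_distrib, ← Finset.sum_mul, ← Finset.sum_mul, hcdef, sum_mulVec_Xbar,
    one_mul, one_mul] at hs
  rw [hs]
  exact sub_self _

/-- The value of a function of the path up to time `k + 1`, as a function of the path up to
time `k` and the state at time `k + 1`. -/
lemma exists_eq_apply_state {k : ℕ} {φ : Ω → ℝ} (hφ : S.PathDependent (k + 1) φ) :
    ∃ h : Ω → Fin n → ℝ, S.PathDependent k h ∧ ∀ ω, φ ω = h ω (S.state (k + 1) ω) := by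
  classical
  let r : Ω → Fin n → Ω → Prop := fun ω j ω' => S.SamePath k ω ω' ∧ S.state (k + 1) ω' = j
  have key : ∀ ω j ω', S.SamePath k ω ω' → r ω j = r ω' j := fun ω j ω' hω => by
    funext ω''
    exact propext ⟨fun h => ⟨hω.symm.trans S h.1, h.2⟩, fun h => ⟨hω.trans S h.1, h.2⟩⟩
  refine ⟨fun ω j => if hr : ∃ ω', r ω j ω' then φ hr.choose else 0, ?_, ?_⟩
  · intro ω ω' hω
    funext j
    simp only [key ω j ω' hω]
  · intro ω
    have hr : ∃ ω', r ω (S.state (k + 1) ω) ω' := ⟨ω, fun _ _ => rfl, rfl⟩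
    simp only [dif_pos hr]
    apply hφ
    intro j hj
    rcases Nat.le_succ_iff.1 hj with h | rfl
    · exact hr.choose_spec.1 j h
    · rw [S.Xbar_eq, S.Xbar_eq, hr.choose_spec.2]

/-- Decomposition of an integral along the state at time `k`. -/
lemma setIntegral_eq_sum_state [IsFiniteMeasure μ] (k : ℕ) (A : Set Ω) {φ : Ω → ℝ}
    (hφ : Integrable φ μ) :
    ∫ ω in A, φ ω ∂μ = ∑ i, ∫ ω in A ∩ {ω | S.Xbar k ω = Pi.single i 1}, φ ω ∂μ := by
  classical
  have hms : ∀ i : Fin n, MeasurableSet {ω | S.Xbar k ω = Pi.single i 1} := fun i =>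
    S.hXmeas k (measurableSet_singleton _)
  have e : ∀ ω, φ ω = ∑ i, {ω | S.Xbar k ω = Pi.single i 1}.indicator φ ω := fun ω => by
    simp [Set.indicator_apply, Xbar_eq_single_iff]
  calc ∫ ω in A, φ ω ∂μ
      = ∫ ω in A, ∑ i, {ω | S.Xbar k ω = Pi.single i 1}.indicator φ ω ∂μ := by simp_rw [← e]
    _ = ∑ i, ∫ ω in A, {ω | S.Xbar k ω = Pi.single i 1}.indicator φ ω ∂μ :=
        integral_finsetSum _ fun i _ => (hφ.indicator (hms i)).integrableOn
    _ = _ := Finset.sum_congr rfl fun i _ => setIntegral_indicator (hms i)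

lemma integrable_of_measurable_of_bound [IsFiniteMeasure μ] {φ : Ω → ℝ} (h : Measurable φ)
    (c : ℝ) (hc : ∀ ω, |φ ω| ≤ c) : Integrable φ μ :=
  Integrable.of_bound h.aestronglyMeasurable c (Filter.Eventually.of_forall hc)

lemma abs_Xbar_apply_le (k : ℕ) (ω : Ω) (a : Fin n) : |S.Xbar k ω a| ≤ 1 := by
  rw [Xbar_eq, Pi.single_apply]
  split_ifs <;> simp

lemma measurable_Xbar_apply {j k : ℕ} (h : j ≤ k) (a : Fin n) :
    Measurable[S.F k] fun ω => S.Xbar j ω a :=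
  (measurable_pi_apply a).comp (S.measurable_Xbar h)

lemma pathDependent_transition (k : ℕ) (a : Fin n) :
    S.PathDependent k fun ω => (S.C *ᵥ S.Xbar k ω) a := fun ω ω' hω => by
  simp only [hω.Xbar_eq]

lemma mulVec_Xbar_le_one (k : ℕ) (ω : Ω) (a : Fin n) : (S.C *ᵥ S.Xbar k ω) a ≤ 1 := by
  rw [← S.sum_mulVec_Xbar k ω]
  exact Finset.single_le_sum (fun i _ => S.mulVec_Xbar_nonneg k ω i) (Finset.mem_univ a)

lemma condExp_Xbar [IsFiniteMeasure μ] {k : ℕ} (hk : k < T) (a : Fin n) :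
    μ[fun ω => S.Xbar (k + 1) ω a | S.F k] =ᵐ[μ] fun ω => (S.C *ᵥ S.Xbar k ω) a := by
  have hle := S.le_ambient k
  have hcm : Measurable[S.F k] fun ω => (S.C *ᵥ S.Xbar k ω) a :=
    PathDependent.measurable S (S.pathDependent_transition k a)
  have hci : Integrable (fun ω => (S.C *ᵥ S.Xbar k ω) a) μ :=
    integrable_of_measurable_of_bound (hcm.mono hle le_rfl) 1 fun ω => by
      rw [abs_of_nonneg (S.mulVec_Xbar_nonneg k ω a)]
      exact S.mulVec_Xbar_le_one k ω a
  have hXi : Integrable (fun ω => S.Xbar (k + 1) ω a) μ :=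
    integrable_of_measurable_of_bound
      ((S.measurable_Xbar_apply le_rfl a).mono (S.le_ambient (k + 1)) le_rfl) 1
      fun ω => S.abs_Xbar_apply_le _ _ _
  refine (ae_eq_condExp_of_forall_setIntegral_eq hle hXi (fun _ _ _ => hci.integrableOn)
    (fun A hA _ => ?_) hcm.stronglyMeasurable.aestronglyMeasurable).symm
  rw [S.setIntegral_eq_sum_state k A hci, S.setIntegral_eq_sum_state k A hXi]
  refine Finset.sum_congr rfl fun i _ => ?_
  have hAi : MeasurableSet (A ∩ {ω | S.Xbar k ω = Pi.single i 1}) :=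
    (hle A hA).inter (S.hXmeas k (measurableSet_singleton _))
  have hnext : MeasurableSet {ω | S.Xbar (k + 1) ω = Pi.single a 1} :=
    S.hXmeas (k + 1) (measurableSet_singleton _)
  have h1 : ∫ ω in A ∩ {ω | S.Xbar k ω = Pi.single i 1}, (S.C *ᵥ S.Xbar k ω) a ∂μ
      = S.C a i * μ.real (A ∩ {ω | S.Xbar k ω = Pi.single i 1}) := by
    rw [setIntegral_congr_fun (g := fun _ => S.C a i) hAi, setIntegral_const, smul_eq_mul,
      mul_comm]
    intro ω hω
    simp only [S.mulVec_Xbar_apply, (S.Xbar_eq_single_iff _ _ _).1 hω.2]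
  have h2 : ∫ ω in A ∩ {ω | S.Xbar k ω = Pi.single i 1}, S.Xbar (k + 1) ω a ∂μ
      = μ.real (A ∩ {ω | S.Xbar k ω = Pi.single i 1}
          ∩ {ω | S.Xbar (k + 1) ω = Pi.single a 1}) := by
    have e : (fun ω => S.Xbar (k + 1) ω a)
        = {ω | S.Xbar (k + 1) ω = Pi.single a 1}.indicator fun _ => 1 := by
      classical
      funext ω
      simp only [Set.indicator_apply, Set.mem_ofPred_eq, Xbar_eq_single_iff]
      rw [Xbar_eq, Pi.single_apply]
      simp only [eq_comm]
    rw [e, setIntegral_indicator hnext, setIntegral_const]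
    simp
  rw [h1, h2, Set.inter_right_comm, measureReal_def, measureReal_def, S.hMarkov k hk i a A hA,
    ENNReal.toReal_mul, ENNReal.toReal_ofReal (S.hCnonneg a i)]

/-- The conditional expectation of a function of the path up to time `k` and the next state. -/
lemma condExp_apply_state [IsFiniteMeasure μ] {k : ℕ} (hk : k < T) {φ : Ω → Fin n → ℝ}
    (hφ : S.PathDependent k φ) (c : ℝ) (hc : ∀ ω j, |φ ω j| ≤ c) :
    μ[fun ω => φ ω (S.state (k + 1) ω) | S.F k]
      =ᵐ[μ] fun ω => ∑ j, φ ω j * (S.C *ᵥ S.Xbar k ω) j := by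
  have hle := S.le_ambient k
  have hφm : ∀ j, Measurable[S.F k] fun ω => φ ω j := fun j =>
    PathDependent.measurable S fun ω ω' hω => by simp only [hφ hω]
  have hXm : ∀ j, Measurable fun ω => S.Xbar (k + 1) ω j := fun j =>
    (S.measurable_Xbar_apply le_rfl j).mono (S.le_ambient (k + 1)) le_rfl
  have hXi : ∀ j, Integrable (fun ω => S.Xbar (k + 1) ω j) μ := fun j =>
    integrable_of_measurable_of_bound (hXm j) 1 fun ω => S.abs_Xbar_apply_le _ _ _
  have hi : ∀ j, Integrable ((fun ω => φ ω j) * fun ω => S.Xbar (k + 1) ω j) μ := fun j =>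
    (hXi j).bdd_mul ((hφm j).mono hle le_rfl).aestronglyMeasurable
      (Filter.Eventually.of_forall fun ω => hc ω j)
  have e : (fun ω => φ ω (S.state (k + 1) ω))
      = ∑ j, (fun ω => φ ω j) * fun ω => S.Xbar (k + 1) ω j := by
    funext ω
    simp [S.Xbar_eq (k + 1), Finset.sum_apply, Pi.single_apply]
  have hj : ∀ᵐ ω ∂μ, ∀ j, (μ[(fun ω => φ ω j) * fun ω => S.Xbar (k + 1) ω j | S.F k]) ω
      = φ ω j * (S.C *ᵥ S.Xbar k ω) j := by
    rw [ae_all_iff]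
    intro j
    filter_upwards [condExp_mul_of_stronglyMeasurable_left (hφm j).stronglyMeasurable (hi j)
      (hXi j), S.condExp_Xbar hk j] with ω h1 h2
    rw [h1, Pi.mul_apply, h2]
  rw [e]
  filter_upwards [condExp_finsetSum (s := Finset.univ) (fun j _ => hi j) (S.F k), hj]
    with ω h1 h2
  rw [h1, Finset.sum_apply]
  exact Finset.sum_congr rfl fun j _ => h2 j

/-- The conditional covariance of the increments is `diag c - c c'`, with `c` the current
transition probabilities. -/
lemma ae_Psi_eq [IsFiniteMeasure μ] {k : ℕ} (hk : k < T) :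
    ∀ᵐ ω ∂μ, S.Psi k ω = diagonal (S.C *ᵥ S.Xbar k ω)
      - vecMulVec (S.C *ᵥ S.Xbar k ω) (S.C *ᵥ S.Xbar k ω) := by
  have hab : ∀ᵐ ω ∂μ, ∀ a b, S.Psi k ω a b = (diagonal (S.C *ᵥ S.Xbar k ω)
      - vecMulVec (S.C *ᵥ S.Xbar k ω) (S.C *ᵥ S.Xbar k ω)) a b := by
    rw [ae_all_iff]
    intro a
    rw [ae_all_iff]
    intro b
    let d : Fin n → Ω → Fin n → ℝ := fun i ω j =>
      (Pi.single j 1 : Fin n → ℝ) i - (S.C *ᵥ S.Xbar k ω) i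
    have hd : ∀ i ω j, |d i ω j| ≤ 1 := fun i ω j => by
      have h0 := S.mulVec_Xbar_nonneg k ω i
      have h1 := S.mulVec_Xbar_le_one k ω i
      simp only [d, Pi.single_apply]
      split_ifs <;> exact abs_le.2 ⟨by linarith, by linarith⟩
    have hcond := S.condExp_apply_state hk (φ := fun ω j => d a ω j * d b ω j)
      (fun ω ω' hω => by simp only [d, hω.Xbar_eq]) 1 fun ω j => by
        rw [abs_mul]
        exact mul_le_one₀ (hd a ω j) (abs_nonneg _) (hd b ω j)
    have e : (fun ω => S.Mbar (k + 1) ω a * S.Mbar (k + 1) ω b)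
        = fun ω => d a ω (S.state (k + 1) ω) * d b ω (S.state (k + 1) ω) := by
      funext ω
      simp [d, S.hMbar, S.Xbar_eq (k + 1)]
    have hPsi := S.hPsi k a b
    rw [e] at hPsi
    filter_upwards [hcond] with ω hω
    rw [← hPsi] at hω
    refine hω.trans ?_
    set c := S.C *ᵥ S.Xbar k ω with hcdef
    have hsum : ∑ j, c j = 1 := S.sum_mulVec_Xbar k ω
    have hexp : ∀ j, d a ω j * d b ω j * c j
        = (Pi.single j 1 : Fin n → ℝ) a * (Pi.single j 1 : Fin n → ℝ) b * c j
          - c b * ((Pi.single j 1 : Fin n → ℝ) a * c j)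
          - c a * ((Pi.single j 1 : Fin n → ℝ) b * c j) + c a * c b * c j := fun j => by
      simp only [d, ← hcdef]; ring
    have hs : ∀ i, ∑ j, (Pi.single j 1 : Fin n → ℝ) i * c j = c i := fun i => by
      simp [Pi.single_apply]
    have hs2 : ∑ j, (Pi.single j 1 : Fin n → ℝ) a * (Pi.single j 1 : Fin n → ℝ) b * c j
        = diagonal c a b := by
      by_cases hab : a = b
      · subst hab; simp [Pi.single_apply]
      · simp [Pi.single_apply, hab]
    simp only [hexp, Finset.sum_add_distrib, Finset.sum_sub_distrib, ← Finset.mul_sum, hs, hs2,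
      hsum, Matrix.sub_apply, vecMulVec_apply]
    ring
  filter_upwards [hab] with ω hω
  ext a b
  exact hω a b

lemma pathDependent_Psi (k : ℕ) : S.PathDependent k (S.Psi k) := fun ω ω' hω => by
  ext a b
  have h : Measurable[S.F k] fun ω => S.Psi k ω a b := by
    rw [S.hPsi]
    exact stronglyMeasurable_condExp.measurable
  exact PathDependent.of_measurable S h hω

lemma pathDependent_Psid_mul_Psi (k : ℕ) :
    S.PathDependent k fun ω => S.Psid k ω * S.Psi k ω := fun ω ω' hω => by
  have h := S.pathDependent_Psi k hω
  have h1 := S.hMP1 k ω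
  have h4 := S.hMP4 k ω
  rw [h] at h1 h4
  simp only [h]
  exact mul_eq_mul_of_generalizedInverse h1 (S.hMP1 k ω') h4 (S.hMP4 k ω')

section Comparison

open scoped Matrix.Norms.Frobenius

/-- Comparison over one time step. -/
lemma ae_nonneg_of_step [IsFiniteMeasure μ] {k : ℕ} (hk : k < T) {l : ℝ} (hl : 0 < l)
    (hsmall : ∀ᵐ ω ∂μ, Real.sqrt 2 * l * ‖S.Psi k ω‖ * ‖S.Psid k ω‖ ^ 2 ≤ 1)
    {y y' D a : Ω → ℝ} {z b : Ω → Fin n → ℝ}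
    (hy : S.PathDependent k y) (hy' : S.PathDependent (k + 1) y') (hDp : S.PathDependent k D)
    (hz : S.PathDependent k z) (ha : ∀ ω, a ω < 1) (hb : ∀ ω, Real.sqrt (b ω ⬝ᵥ b ω) ≤ l)
    (hstep : ∀ᵐ ω ∂μ, y ω = y' ω + D ω - z ω ⬝ᵥ S.Mbar (k + 1) ω)
    (hD : ∀ ω, a ω * y ω + b ω ⬝ᵥ ((S.Psid k ω * S.Psi k ω) *ᵥ z ω) ≤ D ω)
    (hnonneg : ∀ᵐ ω ∂μ, 0 ≤ y' ω) : ∀ᵐ ω ∂μ, 0 ≤ y ω := by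
  obtain ⟨h, hh, hy'h⟩ := S.exists_eq_apply_state hy'
  have hall := S.ae_forall_of_ae_next hk
    (p := fun ω j => y ω = h ω j + D ω - (z ω j - (S.C *ᵥ S.Xbar k ω) ⬝ᵥ z ω) ∧ 0 ≤ h ω j)
    (fun j ω ω' hω => by simp only [hy hω, hDp hω, hz hω, hh hω, hω.Xbar_eq])
    (by
      filter_upwards [hstep, hnonneg] with ω h1 h2
      rw [hy'h] at h1 h2
      rw [dotProduct_Mbar] at h1
      exact ⟨h1, h2⟩)
  filter_upwards [hall, hsmall, S.ae_Psi_eq hk] with ω h1 h2 h3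
  have h4 := S.hMP1 k ω
  have h5 := hD ω
  rw [h3] at h2 h4 h5
  exact nonneg_of_onestep _ (S.mulVec_Xbar_nonneg k ω) (S.sum_mulVec_Xbar k ω) _ h4 hl h2
    (b ω) (hb ω) (ha ω) (fun j hj => (h1 j hj).1) (fun j hj => (h1 j hj).2) h5

/-- Comparison theorem for backward equations, in one-step form. -/
lemma ae_le_of_steps [IsFiniteMeasure μ] {l : ℝ} (hl : 0 < l)
    (hsmall : ∀ k < T, ∀ᵐ ω ∂μ, Real.sqrt 2 * l * ‖S.Psi k ω‖ * ‖S.Psid k ω‖ ^ 2 ≤ 1)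
    {Y Y' d d' a : ℕ → Ω → ℝ} {Z Z' b : ℕ → Ω → Fin n → ℝ}
    (hY : ∀ k ≤ T, S.PathDependent k (Y k)) (hY' : ∀ k ≤ T, S.PathDependent k (Y' k))
    (hZ : ∀ k < T, S.PathDependent k (Z k)) (hZ' : ∀ k < T, S.PathDependent k (Z' k))
    (hd : ∀ k < T, S.PathDependent k (d k)) (hd' : ∀ k < T, S.PathDependent k (d' k))
    (ha : ∀ k < T, ∀ ω, a k ω < 1) (hb : ∀ k < T, ∀ ω, Real.sqrt (b k ω ⬝ᵥ b k ω) ≤ l)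
    (hstep : ∀ k < T, ∀ᵐ ω ∂μ, Y k ω = Y (k + 1) ω + d k ω - Z k ω ⬝ᵥ S.Mbar (k + 1) ω)
    (hstep' : ∀ k < T, ∀ᵐ ω ∂μ, Y' k ω = Y' (k + 1) ω + d' k ω - Z' k ω ⬝ᵥ S.Mbar (k + 1) ω)
    (hdd : ∀ k < T, ∀ ω, a k ω * (Y k ω - Y' k ω)
      + b k ω ⬝ᵥ ((S.Psid k ω * S.Psi k ω) *ᵥ (Z k ω - Z' k ω)) ≤ d k ω - d' k ω)
    (hT : ∀ᵐ ω ∂μ, Y T ω = Y' T ω) {i : ℕ} (hi : i ≤ T) : ∀ᵐ ω ∂μ, Y' i ω ≤ Y i ω := by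
  induction hi using Nat.decreasingInduction with
  | self => filter_upwards [hT] with ω hω using hω.ge
  | of_succ k hk ih =>
    have := S.ae_nonneg_of_step hk hl (hsmall k hk) (y := fun ω => Y k ω - Y' k ω)
      (y' := fun ω => Y (k + 1) ω - Y' (k + 1) ω) (D := fun ω => d k ω - d' k ω)
      (z := fun ω => Z k ω - Z' k ω)
      (fun ω ω' hω => by simp only [hY k hk.le hω, hY' k hk.le hω])
      (fun ω ω' hω => by simp only [hY (k + 1) hk hω, hY' (k + 1) hk hω])
      (fun ω ω' hω => by simp only [hd k hk hω, hd' k hk hω])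
      (fun ω ω' hω => by simp only [hZ k hk hω, hZ' k hk hω])
      (ha k hk) (hb k hk)
      (by
        filter_upwards [hstep k hk, hstep' k hk] with ω h1 h2
        rw [sub_dotProduct]; linarith)
      (hdd k hk) (by filter_upwards [ih] with ω hω using sub_nonneg.2 hω)
    filter_upwards [this] with ω hω using sub_nonneg.1 hω

end Comparison

/-- Solvability of backward equations whose driver is a contraction in `y`. -/
lemma exists_solution {F : Ω → ℕ → ℝ → (Fin n → ℝ) → ℝ}
    (hF : ∀ k < T, S.PathDependent k fun ω => F ω k) {p : ℝ} (hp : 0 ≤ p) (hp1 : p < 1)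
    (hlip : ∀ ω k y y' z, |F ω k y z - F ω k y' z| ≤ p * |y - y'|)
    {ξ : Ω → ℝ} (hξ : S.PathDependent T ξ) :
    ∃ Y : ℕ → Ω → ℝ, ∃ Z : ℕ → Ω → Fin n → ℝ, (∀ k ≤ T, S.PathDependent k (Y k)) ∧
      (∀ k < T, S.PathDependent k (Z k)) ∧ Y T = ξ ∧
      ∀ k < T, ∀ ω, Y k ω = Y (k + 1) ω + F ω k (Y k ω) (Z k ω)
        - Z k ω ⬝ᵥ S.Mbar (k + 1) ω := by
  have hone : ∀ k, ∀ φ : Ω → ℝ, ∃ y : Ω → ℝ, ∃ z : Ω → Fin n → ℝ, k < T →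
      S.PathDependent (k + 1) φ → S.PathDependent k y ∧ S.PathDependent k z ∧
      ∀ ω, y ω = φ ω + F ω k (y ω) (z ω) - z ω ⬝ᵥ S.Mbar (k + 1) ω := by
    intro k φ
    by_cases hφ : k < T ∧ S.PathDependent (k + 1) φ
    swap
    · exact ⟨0, 0, fun h1 h2 => absurd ⟨h1, h2⟩ hφ⟩
    obtain ⟨hk, hφ⟩ := hφ
    obtain ⟨z, hz, hφz⟩ := S.exists_eq_apply_state hφ
    let G : Ω → ℝ → ℝ := fun ω y => (S.C *ᵥ S.Xbar k ω) ⬝ᵥ z ω + F ω k y (z ω)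
    have hG : S.PathDependent k G := fun ω ω' hω => by
      funext y
      simp only [G, hz hω, hω.Xbar_eq, congrFun (congrFun (hF k hk hω) y) (z ω')]
    have hfix : ∀ ω, ∃ y, y = G ω y := fun ω => by
      have hc : ContractingWith ⟨p, hp⟩ (G ω) := by
        refine ⟨hp1, LipschitzWith.of_dist_le_mul fun y y' => ?_⟩
        simp only [G, Real.dist_eq, add_sub_add_left_eq_sub]
        exact hlip ω k y y' (z ω)
      exact ⟨_, hc.fixedPoint_isFixedPt.symm⟩
    refine ⟨fun ω => Classical.epsilon fun y => y = G ω y, z, fun _ _ => ⟨?_, hz, ?_⟩⟩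
    · intro ω ω' hω
      simp only [hG hω]
    · intro ω
      have h1 := Classical.epsilon_spec (hfix ω)
      refine h1.trans ?_
      simp only [G, hφz ω, dotProduct_Mbar]
      ring
  choose y z hyz using hone
  have hback : ∀ m, m ≤ T → ∃ Y : ℕ → Ω → ℝ, ∃ Z : ℕ → Ω → Fin n → ℝ,
      (∀ k, m ≤ k → k ≤ T → S.PathDependent k (Y k)) ∧
      (∀ k, m ≤ k → k < T → S.PathDependent k (Z k)) ∧ Y T = ξ ∧
      ∀ k, m ≤ k → k < T → ∀ ω, Y k ω = Y (k + 1) ω + F ω k (Y k ω) (Z k ω)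
        - Z k ω ⬝ᵥ S.Mbar (k + 1) ω := by
    intro m hm
    induction hm using Nat.decreasingInduction with
    | self =>
      refine ⟨fun _ => ξ, 0, fun k h1 h2 => ?_, fun k h1 h2 => absurd h2 (not_lt.2 h1), rfl,
        fun k h1 h2 => absurd h2 (not_lt.2 h1)⟩
      rwa [le_antisymm h2 h1]
    | of_succ m hm ih =>
      obtain ⟨Y, Z, hY, hZ, hYT, hYZ⟩ := ih
      obtain ⟨h1, h2, h3⟩ := hyz m (Y (m + 1)) hm (hY (m + 1) le_rfl hm)
      refine ⟨Function.update Y m (y m (Y (m + 1))), Function.update Z m (z m (Y (m + 1))),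
        fun k hmk hk => ?_, fun k hmk hk => ?_, ?_, fun k hmk hk ω => ?_⟩
      · rcases hmk.eq_or_lt with rfl | hlt
        · rwa [Function.update_self]
        · rw [Function.update_of_ne hlt.ne']
          exact hY k hlt hk
      · rcases hmk.eq_or_lt with rfl | hlt
        · rwa [Function.update_self]
        · rw [Function.update_of_ne hlt.ne']
          exact hZ k hlt hk
      · rwa [Function.update_of_ne hm.ne']
      · rw [Function.update_of_ne (Nat.lt_succ_of_le hmk).ne' _ Y]
        rcases hmk.eq_or_lt with rfl | hlt
        · rw [Function.update_self, Function.update_self]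
          exact h3 ω
        · rw [Function.update_of_ne hlt.ne', Function.update_of_ne hlt.ne']
          exact hYZ k hlt hk ω
  obtain ⟨Y, Z, hY, hZ, hYT, hYZ⟩ := hback 0 (Nat.zero_le T)
  exact ⟨Y, Z, fun k => hY k k.zero_le, fun k => hZ k k.zero_le, hYT, fun k => hYZ k k.zero_le⟩

end SMCSetup

/-- A backward equation in summed form is equivalent to its one-step form. -/
lemma ae_eq_add_sum_sub_sum_iff {Ω : Type*} [MeasurableSpace Ω] {μ : Measure Ω} {T : ℕ}
    {Y d m : ℕ → Ω → ℝ} {ξ : Ω → ℝ} (hT : ∀ᵐ ω ∂μ, Y T ω = ξ ω) :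
    (∀ i < T, ∀ᵐ ω ∂μ, Y i ω = ξ ω + (∑ k ∈ Finset.Ico i T, d k ω)
      - ∑ k ∈ Finset.Ico i T, m k ω) ↔
    ∀ i < T, ∀ᵐ ω ∂μ, Y i ω = Y (i + 1) ω + d i ω - m i ω := by
  constructor
  · intro h i hi
    have hnext : ∀ᵐ ω ∂μ, Y (i + 1) ω = ξ ω + (∑ k ∈ Finset.Ico (i + 1) T, d k ω)
        - ∑ k ∈ Finset.Ico (i + 1) T, m k ω := by
      rcases (Nat.succ_le_of_lt hi).eq_or_lt with rfl | hlt
      · simpa using hT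
      · exact h (i + 1) hlt
    filter_upwards [h i hi, hnext] with ω h1 h2
    rw [h1, h2, Finset.sum_eq_sum_Ico_succ_bot hi, Finset.sum_eq_sum_Ico_succ_bot hi]
    ring
  · intro h i hi
    have hall : ∀ᵐ ω ∂μ, Y i ω = ξ ω + (∑ k ∈ Finset.Ico i T, d k ω)
        - ∑ k ∈ Finset.Ico i T, m k ω := by
      replace hi := hi.le
      induction hi using Nat.decreasingInduction with
      | self => simpa using hT
      | of_succ k hk ih =>
        filter_upwards [h k hk, ih] with ω h1 h2
        rw [h1, h2, Finset.sum_eq_sum_Ico_succ_bot hk, Finset.sum_eq_sum_Ico_succ_bot hk]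
        ring
    exact hall

/-- the BSDE with maximized driver
`f(k,y,z) = sup_{v ∈ U}[α(k,v)y + β(k,v)Ψ_k†Ψ_k z' + g(k,v)]` has a unique adapted
solution `(Y, Z)`; `Y` dominates `Y^u` for every feasible control `u`, and is the
limit in `L²` of a sequence `Y^{u^{(m)}}`, i.e. `Y_i = esssup {Y_i^u}`. -/
theorem statement10
    {Ω : Type} [mΩ : MeasurableSpace Ω] (μ : Measure Ω) [IsProbabilityMeasure μ]
    (T n : ℕ) (S : SMCSetup Ω μ T n)
    (q : ℕ) (hq : 1 ≤ q)
    (U : Set (Fin q → ℝ)) (hUcompact : IsCompact U) (hUne : U.Nonempty)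
    (p l : ℝ) (hp : 0 < p) (hp1 : p < 1) (hl : 0 < l)
    (α g : Ω → ℕ → (Fin q → ℝ) → ℝ) (β : Ω → ℕ → (Fin q → ℝ) → (Fin n → ℝ))
    -- measurability in `(ω, v)` with respect to `ℱ_k ⊗ Borel(U)` and continuity in `v`
    (hαmeas : ∀ k, k < T → Measurable[(S.F k).prod inferInstance]
      (fun pr : Ω × (Fin q → ℝ) => α pr.1 k pr.2))
    (hβmeas : ∀ k, k < T → Measurable[(S.F k).prod inferInstance]
      (fun pr : Ω × (Fin q → ℝ) => β pr.1 k pr.2))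
    (hgmeas : ∀ k, k < T → Measurable[(S.F k).prod inferInstance]
      (fun pr : Ω × (Fin q → ℝ) => g pr.1 k pr.2))
    (hαcont : ∀ ω k, ContinuousOn (α ω k) U)
    (hβcont : ∀ ω k, ContinuousOn (β ω k) U)
    (hgcont : ∀ ω k, ContinuousOn (g ω k) U)
    -- uniform bounds
    (hαbdd : ∀ ω k v, v ∈ U → |α ω k v| ≤ p)
    (hβbdd : ∀ ω k v, v ∈ U → Real.sqrt (β ω k v ⬝ᵥ β ω k v) ≤ l)
    (hgbdd : ∃ cg : ℝ, ∀ ω k v, v ∈ U → |g ω k v| ≤ cg)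
    -- terminal condition
    (ξ : Ω → ℝ) (hξmeas : Measurable[S.F T] ξ)
    (hξbdd : ∃ c : ℝ, ∀ᵐ ω ∂μ, |ξ ω| ≤ c)
    -- the hypothesis `√2·l·‖Ψ_i‖·‖Ψ_i†‖² ≤ 1` (Frobenius norms)
    (hsqrt2 : ∀ k, k ≤ T → ∀ᵐ ω ∂μ,
      Real.sqrt 2 * l * Real.sqrt (((S.Psi k ω)ᵀ * S.Psi k ω).trace)
          * (Real.sqrt (((S.Psid k ω)ᵀ * S.Psid k ω).trace)) ^ 2 ≤ 1)
    -- the constant `λ` with `|Ψ_i†Ψ_i B| ≤ λ (B'Ψ_i B)^{1/2}`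
    (lam : ℝ) (hlam : 0 < lam)
    (hlamB : ∀ k ω, ∀ B : Fin n → ℝ,
      Real.sqrt (((S.Psid k ω * S.Psi k ω) *ᵥ B) ⬝ᵥ ((S.Psid k ω * S.Psi k ω) *ᵥ B))
        ≤ lam * Real.sqrt (B ⬝ᵥ (S.Psi k ω *ᵥ B)))
    -- the hypothesis `6 l² λ² (Tr(C'C))^{1/2} Tr((Ψ_i†)'Ψ_i†) < 1`
    (hsmall : ∀ i, i < T → ∀ᵐ ω ∂μ,
      6 * l ^ 2 * lam ^ 2 * Real.sqrt ((S.Cᵀ * S.C).trace)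
          * ((S.Psid i ω)ᵀ * S.Psid i ω).trace < 1)
    -- the maximized driver `f`
    (f : Ω → ℕ → ℝ → (Fin n → ℝ) → ℝ)
    (hf : ∀ ω k y z, f ω k y z =
      sSup ((fun v => α ω k v * y + β ω k v ⬝ᵥ ((S.Psid k ω * S.Psi k ω) *ᵥ z) + g ω k v)
        '' U)) :
    ∃ Y : ℕ → Ω → ℝ, ∃ Z : ℕ → Ω → (Fin n → ℝ),
      -- (1) existence of an adapted solution of the BSDE with driver `f`
      (∀ i, i ≤ T → Measurable[S.F i] (Y i)) ∧
      (∀ i, i < T → Measurable[S.F i] (Z i)) ∧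
      (∀ᵐ ω ∂μ, Y T ω = ξ ω) ∧
      (∀ i, i < T → ∀ᵐ ω ∂μ,
        Y i ω = ξ ω + (∑ k ∈ Finset.Ico i T, f ω k (Y k ω) (Z k ω))
          - ∑ k ∈ Finset.Ico i T, Z k ω ⬝ᵥ S.Mbar (k + 1) ω) ∧
      -- (1') uniqueness
      (∀ Y' : ℕ → Ω → ℝ, ∀ Z' : ℕ → Ω → (Fin n → ℝ),
        (∀ i, i ≤ T → Measurable[S.F i] (Y' i)) →
        (∀ i, i < T → Measurable[S.F i] (Z' i)) →
        (∀ᵐ ω ∂μ, Y' T ω = ξ ω) →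
        (∀ i, i < T → ∀ᵐ ω ∂μ,
          Y' i ω = ξ ω + (∑ k ∈ Finset.Ico i T, f ω k (Y' k ω) (Z' k ω))
            - ∑ k ∈ Finset.Ico i T, Z' k ω ⬝ᵥ S.Mbar (k + 1) ω) →
        (∀ i, i ≤ T → Y i =ᵐ[μ] Y' i) ∧
        (∀ i, i < T →
          (fun ω => Z i ω ⬝ᵥ S.Mbar (i + 1) ω)
            =ᵐ[μ] fun ω => Z' i ω ⬝ᵥ S.Mbar (i + 1) ω)) ∧
      -- (2) `Y^u_i ≤ Y_i` a.s. for every feasible control `u`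
      (∀ u : ℕ → Ω → (Fin q → ℝ),
        (∀ k, k < T → Measurable[S.F k] (u k) ∧ ∀ ω, u k ω ∈ U) →
        ∀ Yu : ℕ → Ω → ℝ, ∀ Zu : ℕ → Ω → (Fin n → ℝ),
        (∀ i, i ≤ T → Measurable[S.F i] (Yu i)) →
        (∀ i, i < T → Measurable[S.F i] (Zu i)) →
        (∀ᵐ ω ∂μ, Yu T ω = ξ ω) →
        (∀ i, i < T → ∀ᵐ ω ∂μ,
          Yu i ω = ξ ω
            + (∑ k ∈ Finset.Ico i T,
                (α ω k (u k ω) * Yu k ω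
                  + β ω k (u k ω) ⬝ᵥ ((S.Psid k ω * S.Psi k ω) *ᵥ Zu k ω)
                  + g ω k (u k ω)))
            - ∑ k ∈ Finset.Ico i T, Zu k ω ⬝ᵥ S.Mbar (k + 1) ω) →
        ∀ i, i < T → ∀ᵐ ω ∂μ, Yu i ω ≤ Y i ω) ∧
      -- (3) a maximizing sequence of feasible controls: `Y^{u^{(m)}}_i → Y_i` in `L²`
      (∃ us : ℕ → ℕ → Ω → (Fin q → ℝ),
        ∃ Yus : ℕ → ℕ → Ω → ℝ, ∃ Zus : ℕ → ℕ → Ω → (Fin n → ℝ),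
        (∀ m : ℕ,
          (∀ k, k < T → Measurable[S.F k] (us m k) ∧ ∀ ω, us m k ω ∈ U) ∧
          (∀ i, i ≤ T → Measurable[S.F i] (Yus m i)) ∧
          (∀ i, i < T → Measurable[S.F i] (Zus m i)) ∧
          (∀ᵐ ω ∂μ, Yus m T ω = ξ ω) ∧
          (∀ i, i < T → ∀ᵐ ω ∂μ,
            Yus m i ω = ξ ω
              + (∑ k ∈ Finset.Ico i T,
                  (α ω k (us m k ω) * Yus m k ω
                    + β ω k (us m k ω) ⬝ᵥ ((S.Psid k ω * S.Psi k ω) *ᵥ Zus m k ω)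
                    + g ω k (us m k ω)))
              - ∑ k ∈ Finset.Ico i T, Zus m k ω ⬝ᵥ S.Mbar (k + 1) ω)) ∧
        (∀ i, i < T →
          Filter.Tendsto (fun m => ∫ ω, (Y i ω - Yus m i ω) ^ 2 ∂μ)
            Filter.atTop (nhds 0))) := by
  have hαp : ∀ k < T, S.PathDependent k fun ω => α ω k := fun k hk ω ω' hω =>
    funext fun v => SMCSetup.PathDependent.of_measurable S
      ((hαmeas k hk).comp (measurable_prodMk_right (y := v))) hω
  have hβp : ∀ k < T, S.PathDependent k fun ω => β ω k := fun k hk ω ω' hω =>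
    funext fun v => SMCSetup.PathDependent.of_measurable S
      ((hβmeas k hk).comp (measurable_prodMk_right (y := v))) hω
  have hgp : ∀ k < T, S.PathDependent k fun ω => g ω k := fun k hk ω ω' hω =>
    funext fun v => SMCSetup.PathDependent.of_measurable S
      ((hgmeas k hk).comp (measurable_prodMk_right (y := v))) hω
  let L : Ω → ℕ → ℝ → (Fin n → ℝ) → (Fin q → ℝ) → ℝ := fun ω k y z v =>
    α ω k v * y + β ω k v ⬝ᵥ ((S.Psid k ω * S.Psi k ω) *ᵥ z) + g ω k v
  have hLp : ∀ k < T, S.PathDependent k fun ω => L ω k := fun k hk ω ω' hω => by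
    funext y z v
    have h1 := congrFun (hαp k hk hω) v
    have h2 := congrFun (hβp k hk hω) v
    have h3 := congrFun (hgp k hk hω) v
    have h4 := S.pathDependent_Psid_mul_Psi k hω
    simp only [L] at *
    rw [h1, h2, h3, h4]
  have hLcont : ∀ ω k y z, ContinuousOn (L ω k y z) U := fun ω k y z => by
    have hd : Continuous fun b : Fin n → ℝ => b ⬝ᵥ ((S.Psid k ω * S.Psi k ω) *ᵥ z) :=
      continuous_id.dotProduct continuous_const
    exact (((hαcont ω k).mul continuousOn_const).add (hd.comp_continuousOn (hβcont ω k))).add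
      (hgcont ω k)
  have hfL : ∀ ω k y z, f ω k y z = sSup (L ω k y z '' U) := hf
  have hmax : ∀ ω k y z, ∃ v, (v ∈ U ∧ sSup (L ω k y z '' U) = L ω k y z v) ∧
      ∀ w ∈ U, L ω k y z w ≤ f ω k y z := fun ω k y z => by
    obtain ⟨v, hv, h1, h2⟩ := hUcompact.exists_sSup_image_eq_and_ge hUne (hLcont ω k y z)
    exact ⟨v, ⟨hv, h1⟩, fun w hw => by rw [hfL, h1]; exact h2 w hw⟩
  have hfp : ∀ k < T, S.PathDependent k fun ω => f ω k := fun k hk ω ω' hω => by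
    funext y z
    have h1 := congrFun (congrFun (hLp k hk hω) y) z
    simp only [hfL] at *
    rw [h1]
  have hfsub : ∀ ω k y y' z, f ω k y z - f ω k y' z ≤ p * |y - y'| := fun ω k y y' z => by
    obtain ⟨v, ⟨hv, h1⟩, -⟩ := hmax ω k y z
    obtain ⟨-, -, h2⟩ := hmax ω k y' z
    have h3 := h2 v hv
    have h4 : L ω k y z v - L ω k y' z v = α ω k v * (y - y') := by simp only [L]; ring
    have h5 : α ω k v * (y - y') ≤ p * |y - y'| := by
      refine (le_abs_self _).trans ?_
      rw [abs_mul]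
      exact mul_le_mul_of_nonneg_right (hαbdd ω k v hv) (abs_nonneg _)
    rw [← hfL] at h1
    linarith
  have hlip : ∀ ω k y y' z, |f ω k y z - f ω k y' z| ≤ p * |y - y'| := fun ω k y y' z =>
    abs_sub_le_iff.2 ⟨hfsub ω k y y' z, abs_sub_comm y y' ▸ hfsub ω k y' y z⟩
  have hsmallF : ∀ k < T, ∀ᵐ ω ∂μ, Real.sqrt 2 * l
      * Real.sqrt (((S.Psi k ω)ᵀ * S.Psi k ω).trace)
      * (Real.sqrt (((S.Psid k ω)ᵀ * S.Psid k ω).trace)) ^ 2 ≤ 1 := fun k hk => hsqrt2 k hk.le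
  simp only [sqrt_trace_transpose_mul_self] at hsmallF
  -- comparison of a solution for the maximized driver with one for a feasible control
  have hcomp : ∀ (Y : ℕ → Ω → ℝ) (Z : ℕ → Ω → Fin n → ℝ) (u : ℕ → Ω → Fin q → ℝ)
      (Y' : ℕ → Ω → ℝ) (Z' : ℕ → Ω → Fin n → ℝ),
      (∀ k ≤ T, S.PathDependent k (Y k)) → (∀ k < T, S.PathDependent k (Z k)) →
      (∀ k < T, S.PathDependent k (u k) ∧ ∀ ω, u k ω ∈ U) →
      (∀ k ≤ T, S.PathDependent k (Y' k)) → (∀ k < T, S.PathDependent k (Z' k)) →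
      (∀ᵐ ω ∂μ, Y T ω = ξ ω) → (∀ᵐ ω ∂μ, Y' T ω = ξ ω) →
      (∀ i < T, ∀ᵐ ω ∂μ, Y i ω = Y (i + 1) ω + f ω i (Y i ω) (Z i ω)
        - Z i ω ⬝ᵥ S.Mbar (i + 1) ω) →
      (∀ i < T, ∀ᵐ ω ∂μ, Y' i ω = Y' (i + 1) ω + L ω i (Y' i ω) (Z' i ω) (u i ω)
        - Z' i ω ⬝ᵥ S.Mbar (i + 1) ω) →
      ∀ i ≤ T, ∀ᵐ ω ∂μ, Y' i ω ≤ Y i ω := by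
    intro Y Z u Y' Z' hY hZ hu hY' hZ' hT hT' hYs hYs' i hi
    refine S.ae_le_of_steps hl hsmallF hY hY' hZ hZ'
      (d := fun k ω => f ω k (Y k ω) (Z k ω)) (d' := fun k ω => L ω k (Y' k ω) (Z' k ω) (u k ω))
      (a := fun k ω => α ω k (u k ω)) (b := fun k ω => β ω k (u k ω))
      (fun k hk ω ω' hω => ?_) (fun k hk ω ω' hω => ?_)
      (fun k hk ω => ((le_abs_self _).trans (hαbdd ω k _ ((hu k hk).2 ω))).trans_lt hp1)
      (fun k hk ω => hβbdd ω k _ ((hu k hk).2 ω)) hYs hYs' (fun k hk ω => ?_)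
      (by filter_upwards [hT, hT'] with ω h1 h2 using h1.trans h2.symm) hi
    · have h1 := hfp k hk hω
      simp only [hY k hk.le hω, hZ k hk hω] at h1 ⊢
      rw [h1]
    · have h1 := hLp k hk hω
      simp only [hY' k hk.le hω, hZ' k hk hω, (hu k hk).1 hω] at h1 ⊢
      rw [h1]
    · obtain ⟨-, -, h1⟩ := hmax ω k (Y k ω) (Z k ω)
      have h2 := h1 _ ((hu k hk).2 ω)
      simp only [L] at h2 ⊢
      rw [mulVec_sub, dotProduct_sub]
      linarith
  -- a feasible control attaining the maximum along given processes
  have hsel : ∀ (Y : ℕ → Ω → ℝ) (Z : ℕ → Ω → Fin n → ℝ),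
      (∀ k ≤ T, S.PathDependent k (Y k)) → (∀ k < T, S.PathDependent k (Z k)) →
      ∃ u : ℕ → Ω → Fin q → ℝ, (∀ k < T, S.PathDependent k (u k) ∧ ∀ ω, u k ω ∈ U) ∧
        ∀ k ω, f ω k (Y k ω) (Z k ω) = L ω k (Y k ω) (Z k ω) (u k ω) := by
    intro Y Z hY hZ
    have hspec : ∀ k ω, _ := fun k ω => Classical.epsilon_spec
      (p := fun v => v ∈ U ∧ sSup (L ω k (Y k ω) (Z k ω) '' U) = L ω k (Y k ω) (Z k ω) v)
      ((hmax ω k (Y k ω) (Z k ω)).imp fun _ h => h.1)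
    refine ⟨fun k ω => Classical.epsilon fun v =>
      v ∈ U ∧ sSup (L ω k (Y k ω) (Z k ω) '' U) = L ω k (Y k ω) (Z k ω) v,
      fun k hk => ⟨fun ω ω' hω => ?_, fun ω => (hspec k ω).1⟩,
      fun k ω => (hfL _ _ _ _).trans (hspec k ω).2⟩
    have h1 : L ω k = L ω' k := hLp k hk hω
    simp only [hY k hk.le hω, hZ k hk hω, h1]
  have hle : ∀ (Y Y' : ℕ → Ω → ℝ) (Z Z' : ℕ → Ω → Fin n → ℝ),
      (∀ k ≤ T, S.PathDependent k (Y k)) → (∀ k < T, S.PathDependent k (Z k)) →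
      (∀ k ≤ T, S.PathDependent k (Y' k)) → (∀ k < T, S.PathDependent k (Z' k)) →
      (∀ᵐ ω ∂μ, Y T ω = ξ ω) → (∀ᵐ ω ∂μ, Y' T ω = ξ ω) →
      (∀ i < T, ∀ᵐ ω ∂μ, Y i ω = Y (i + 1) ω + f ω i (Y i ω) (Z i ω)
        - Z i ω ⬝ᵥ S.Mbar (i + 1) ω) →
      (∀ i < T, ∀ᵐ ω ∂μ, Y' i ω = Y' (i + 1) ω + f ω i (Y' i ω) (Z' i ω)
        - Z' i ω ⬝ᵥ S.Mbar (i + 1) ω) →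
      ∀ i ≤ T, ∀ᵐ ω ∂μ, Y' i ω ≤ Y i ω := by
    intro Y Y' Z Z' hY hZ hY' hZ' hT hT' hYs hYs'
    obtain ⟨u, hu, hfu⟩ := hsel Y' Z' hY' hZ'
    refine hcomp Y Z u Y' Z' hY hZ hu hY' hZ' hT hT' hYs fun i hi => ?_
    simpa only [← hfu] using hYs' i hi
  obtain ⟨Y, Z, hY, hZ, hYT, hYs⟩ :=
    S.exists_solution hfp hp.le hp1 hlip (SMCSetup.PathDependent.of_measurable S hξmeas)
  have hYT' : ∀ᵐ ω ∂μ, Y T ω = ξ ω := Filter.Eventually.of_forall fun ω => by rw [hYT]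
  have hYs' : ∀ i < T, ∀ᵐ ω ∂μ, Y i ω = Y (i + 1) ω + f ω i (Y i ω) (Z i ω)
      - Z i ω ⬝ᵥ S.Mbar (i + 1) ω := fun i hi => Filter.Eventually.of_forall (hYs i hi)
  have hYm : ∀ i, i ≤ T → Measurable[S.F i] (Y i) := fun i hi =>
    SMCSetup.PathDependent.measurable S (hY i hi)
  have hZm : ∀ i, i < T → Measurable[S.F i] (Z i) := fun i hi =>
    SMCSetup.PathDependent.measurable S (hZ i hi)
  have hYsum := (ae_eq_add_sum_sub_sum_iff (d := fun k ω => f ω k (Y k ω) (Z k ω))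
    (m := fun k ω => Z k ω ⬝ᵥ S.Mbar (k + 1) ω) hYT').2 hYs'
  refine ⟨Y, Z, hYm, hZm, hYT', hYsum, ?_, ?_, ?_⟩
  · intro Y' Z' hYm' hZm' hT' hsum'
    have hY' : ∀ k ≤ T, S.PathDependent k (Y' k) := fun k hk =>
      SMCSetup.PathDependent.of_measurable S (hYm' k hk)
    have hZ' : ∀ k < T, S.PathDependent k (Z' k) := fun k hk =>
      SMCSetup.PathDependent.of_measurable S (hZm' k hk)
    have hs' := (ae_eq_add_sum_sub_sum_iff (d := fun k ω => f ω k (Y' k ω) (Z' k ω))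
      (m := fun k ω => Z' k ω ⬝ᵥ S.Mbar (k + 1) ω) hT').1 hsum'
    have heq : ∀ i ≤ T, ∀ᵐ ω ∂μ, Y i ω = Y' i ω := fun i hi => by
      filter_upwards [hle Y Y' Z Z' hY hZ hY' hZ' hYT' hT' hYs' hs' i hi,
        hle Y' Y Z' Z hY' hZ' hY hZ hT' hYT' hs' hYs' i hi] with ω h1 h2 using le_antisymm h2 h1
    refine ⟨heq, fun i hi => ?_⟩
    have hinc : ∀ᵐ ω ∂μ, f ω i (Y i ω) (Z i ω) - f ω i (Y' i ω) (Z' i ω)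
        = (Z i ω - Z' i ω) ⬝ᵥ S.Mbar (i + 1) ω := by
      filter_upwards [heq i hi.le, heq (i + 1) hi, hYs' i hi, hs' i hi] with ω h1 h2 h3 h4
      rw [sub_dotProduct]
      linarith
    have hzero := S.ae_eq_zero_of_eq_dotProduct_Mbar hi
      (a := fun ω => f ω i (Y i ω) (Z i ω) - f ω i (Y' i ω) (Z' i ω))
      (z := fun ω => Z i ω - Z' i ω)
      (fun ω ω' hω => by
        have h1 : f ω i = f ω' i := hfp i hi hω
        simp only [h1, hY i hi.le hω, hZ i hi hω, hY' i hi.le hω, hZ' i hi hω])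
      (fun ω ω' hω => by simp only [hZ i hi hω, hZ' i hi hω]) hinc
    filter_upwards [hinc, hzero] with ω h1 h2
    rw [h2, sub_dotProduct] at h1
    exact sub_eq_zero.1 h1.symm
  · intro u hu Yu Zu hYum hZum hTu hsumu i hi
    have hsu := (ae_eq_add_sum_sub_sum_iff (d := fun k ω => L ω k (Yu k ω) (Zu k ω) (u k ω))
      (m := fun k ω => Zu k ω ⬝ᵥ S.Mbar (k + 1) ω) hTu).1 hsumu
    exact hcomp Y Z u Yu Zu hY hZ
      (fun k hk => ⟨SMCSetup.PathDependent.of_measurable S (hu k hk).1, (hu k hk).2⟩)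
      (fun k hk => SMCSetup.PathDependent.of_measurable S (hYum k hk))
      (fun k hk => SMCSetup.PathDependent.of_measurable S (hZum k hk)) hYT' hTu hYs' hsu i hi.le
  · obtain ⟨u, hu, hfu⟩ := hsel Y Z hY hZ
    refine ⟨fun _ => u, fun _ => Y, fun _ => Z, fun _ =>
      ⟨fun k hk => ⟨SMCSetup.PathDependent.measurable S (hu k hk).1, (hu k hk).2⟩, hYm, hZm, hYT',
        fun i hi => ?_⟩, fun i _ => by simp⟩
    simpa only [hfu, L] using hYsum i hi
end
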